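/- arXiv:2502.21064 — 2 statements merged into one kernel-verified Lean document; each statement's English description precedes it below -/
import Mathlib

section
/- Let M be a d-cluster tilting subcategory of an abelian category A, and let W be a d-wide subcategory of M. Then the subcategories W_d(A) = {X ∈ A : there is an exact sequence 0 → W_d → ⋯ → W_1 → X → 0 with W_i ∈ W} and W^d(A) = {X ∈ A : there is an exact sequence 0 → X → W^1 → ⋯ → W^d → 0 with W^i ∈ W} coincide, and this common subcategory B is a wide (extension-closed, kernel-closed, cokernel-closed) subcategory of A. -/
open CategoryTheory CategoryTheory.Limits

universe v u

variable (A : Type u) [Category.{v} A] [Abelian A]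

/-- An exact sequence `0 → Y → E_n → ⋯ → E_1 → X → 0` with `n` middle terms `E_n, …, E_1`,
encoded as an `ℕ`-indexed complex with `ob 0 ≅ X`, `ob (n+1) ≅ Y`, zero objects in degrees
above `n+1`, exactness at every position `≥ 1` and an epimorphism at the bottom. -/
structure ExtSeq (n : ℕ) (X Y : A) where
  ob : ℕ → A
  d : ∀ i : ℕ, ob (i + 1) ⟶ ob i
  iso0 : ob 0 ≅ X
  isoTop : ob (n + 1) ≅ Y
  is_zero : ∀ i, n + 1 < i → IsZero (ob i)
  w : ∀ i, d (i + 1) ≫ d i = 0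
  ex : ∀ i, (ShortComplex.mk (d (i + 1)) (d i) (w i)).Exact
  epi0 : Epi (d 0)

variable {A}

/-- A morphism of `n`-extensions inducing the identity on the two end terms. -/
structure ExtSeqHom {n : ℕ} {X Y : A} (s t : ExtSeq A n X Y) where
  φ : ∀ i, s.ob i ⟶ t.ob i
  comm : ∀ i, s.d i ≫ φ i = φ (i + 1) ≫ t.d i
  φ0 : φ 0 = s.iso0.hom ≫ t.iso0.inv
  φTop : φ (n + 1) = s.isoTop.hom ≫ t.isoTop.inv

/-- Yoneda equivalence of `n`-fold extensions: the equivalence relation generated by the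
existence of a morphism of extensions fixing the end terms. -/
def YonedaEquiv {n : ℕ} {X Y : A} : ExtSeq A n X Y → ExtSeq A n X Y → Prop :=
  Relation.EqvGen fun s t => Nonempty (ExtSeqHom s t)

variable (A) in
/-- `extVanish A n X Y` expresses the vanishing of the Yoneda Ext-group `Ext^n_A(X, Y)`:
all `n`-fold extensions of `X` by `Y` are Yoneda equivalent. -/
def extVanish (n : ℕ) (X Y : A) : Prop :=
  ∀ s t : ExtSeq A n X Y, YonedaEquiv s t

variable (A) in
/-- `coresSet 𝒰 j` is the class `𝒰^j(A)` of objects `E` admitting an exact sequence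
`0 → E → U^1 → ⋯ → U^j → 0` with all `U^i ∈ 𝒰`. -/
def coresSet (𝒰 : Set A) : ℕ → Set A
  | 0 => {E | IsZero E}
  | j + 1 => {E | ∃ (V : A) (f : E ⟶ V), V ∈ 𝒰 ∧ Mono f ∧ cokernel f ∈ coresSet 𝒰 j}

variable (A) in
/-- `resSet 𝒰 j` is the class `𝒰_j(A)` of objects `E` admitting an exact sequence
`0 → U_j → ⋯ → U_1 → E → 0` with all `U_i ∈ 𝒰`. -/
def resSet (𝒰 : Set A) : ℕ → Set A
  | 0 => {E | IsZero E}
  | j + 1 => {E | ∃ (V : A) (f : V ⟶ E), V ∈ 𝒰 ∧ Epi f ∧ kernel f ∈ resSet 𝒰 j}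

/-- The extension lies (admissibly) in the subcategory `𝒮`: all its terms and all the
images of its differentials (the splice objects) belong to `𝒮`. -/
def ExtSeq.allIn {n : ℕ} {X Y : A} (s : ExtSeq A n X Y) (𝒮 : Set A) : Prop :=
  (∀ i, i ≤ n + 1 → s.ob i ∈ 𝒮) ∧ ∀ i, 1 ≤ i → i ≤ n → (image (s.d i) : A) ∈ 𝒮

/-- Yoneda equivalence computed inside the subcategory `𝒮`: the equivalence relation
generated by morphisms of extensions between extensions lying in `𝒮`. -/
def YonedaEquivIn (𝒮 : Set A) {n : ℕ} {X Y : A} :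
    ExtSeq A n X Y → ExtSeq A n X Y → Prop :=
  Relation.EqvGen fun s t => s.allIn 𝒮 ∧ t.allIn 𝒮 ∧ Nonempty (ExtSeqHom s t)

variable (A) in
/-- `𝒰` is closed under `d`-extensions in `A`. -/
def DExtClosed (𝒰 : Set A) (d : ℕ) : Prop :=
  ∀ (X Y : A), X ∈ 𝒰 → Y ∈ 𝒰 → ∀ s : ExtSeq A d X Y,
    ∃ t : ExtSeq A d X Y, (∀ i, 1 ≤ i → i ≤ d → t.ob i ∈ 𝒰) ∧ YonedaEquiv s t

universe w
namespace DWide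
open Abelian HomologicalComplex

lemma epi_of_quasiIso {X : A} {K : CochainComplex A ℤ} {i : ℤ}
    (π : K ⟶ (HomologicalComplex.single A (ComplexShape.up ℤ) i).obj X) [K.IsStrictlyLE i]
    [QuasiIsoAt π i] : Epi (π.f i ≫ (singleObjXSelf (ComplexShape.up ℤ) i X).hom) := by
  let e := K.iCyclesIso i (i + 1) (by simp)
    ((K.isZero_of_isStrictlyLE i (i + 1) (by simp)).eq_of_tgt _ _)
  let α := e.inv ≫ K.homologyπ i ≫ homologyMap π i ≫ (singleObjHomologySelfIso _ _ _).hom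
  have : π.f i = α ≫ (singleObjXSelf (ComplexShape.up ℤ) i X).inv := by
    rw [← cancel_epi e.hom]
    dsimp only [α, e]
    rw [Category.assoc, Category.assoc, Category.assoc, Iso.hom_inv_id_assoc,
      homologyπ_naturality_assoc]
    rw [homologyπ_singleObjHomologySelfIso_hom_assoc,
      ← singleObjCyclesSelfIso_inv_iCycles, Iso.hom_inv_id_assoc, cyclesMap_i]
    rfl
  rw [this, Category.assoc, Iso.inv_hom_id, Category.comp_id]
  dsimp only [α]
  infer_instance

lemma efface_derived [HasDerivedCategory.{w} A] {X : A} {L : CochainComplex A ℤ}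
    (φ : DerivedCategory.Q.obj ((HomologicalComplex.single A (ComplexShape.up ℤ) 0).obj X) ⟶
      DerivedCategory.Q.obj L) (n : ℤ) (hn : n < 0) [L.IsStrictlyLE n] :
    ∃ (P : A) (p : P ⟶ X), Epi p ∧
      DerivedCategory.Q.map ((HomologicalComplex.single A (ComplexShape.up ℤ) 0).map p) ≫ φ = 0 := by
  have : CochainComplex.IsStrictlyLE ((HomologicalComplex.single A (ComplexShape.up ℤ) 0).obj X) 0 :=
    inferInstanceAs (CochainComplex.IsStrictlyLE ((CochainComplex.singleFunctor A 0).obj X) 0)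
  obtain ⟨K, _, π, h, g, rfl⟩ := DerivedCategory.right_fac_of_isStrictlyLE φ 0
  have hq : QuasiIso π := by rwa [DerivedCategory.isIso_Q_map_iff_quasiIso] at h
  refine ⟨K.X 0, π.f 0 ≫ (singleObjXSelf (ComplexShape.up ℤ) 0 X).hom, epi_of_quasiIso π, ?_⟩
  let ι : (HomologicalComplex.single A (ComplexShape.up ℤ) 0).obj (K.X 0) ⟶ K :=
    mkHomFromSingle (𝟙 _) (by
      rintro i hi
      apply (K.isZero_of_isStrictlyLE 0 i (by simp at hi; lia)).eq_of_tgt)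
  have h1 : (HomologicalComplex.single A (ComplexShape.up ℤ) 0).map
      (π.f 0 ≫ (singleObjXSelf (ComplexShape.up ℤ) 0 X).hom) = ι ≫ π := by
    apply HomologicalComplex.from_single_hom_ext
    rw [single_map_f_self, comp_f, mkHomFromSingle_f]
    simp
  have h2 : ι ≫ g = 0 := by
    apply HomologicalComplex.from_single_hom_ext
    apply (L.isZero_of_isStrictlyLE n 0 hn).eq_of_tgt
  rw [h1, Functor.map_comp, Category.assoc, IsIso.hom_inv_id_assoc, ← Functor.map_comp, h2,
    Functor.map_zero]

lemma efface [HasExt.{w} A] {X Y : A} {n : ℕ} (e : Ext X Y (n + 1)) :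
    ∃ (P : A) (p : P ⟶ X), Epi p ∧ (Ext.mk₀ p).comp e (zero_add _) = 0 := by
  let := HasDerivedCategory.standard A
  obtain ⟨P, p, hp, h⟩ := efface_derived
    (L := (CochainComplex.singleFunctor A (-(n + 1))).obj Y)
    (e.hom ≫ ((DerivedCategory.singleFunctors A).shiftIso (n + 1) (-(n + 1)) 0
    (by lia)).hom.app Y) (-(n + 1)) (by lia)
  refine ⟨P, p, hp, ?_⟩
  ext
  rw [← cancel_mono (((DerivedCategory.singleFunctors A).shiftIso (n + 1) (-(n + 1)) 0
    (by lia)).hom.app _), Ext.zero_hom, Limits.zero_comp, ← Ext.singleFunctor_map_comp_hom,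
    Category.assoc]
  exact h



lemma pushout_shortExact {S : ShortComplex A} (hS : S.ShortExact) {Y E : A} {f : S.X₁ ⟶ Y}
    {g : S.X₂ ⟶ E} {i : Y ⟶ E} (sq : IsPushout S.f f g i) :
    ∃ (p : E ⟶ S.X₃) (hw : i ≫ p = 0), g ≫ p = S.g ∧ (ShortComplex.mk i p hw).ShortExact := by
  have := hS.mono_f
  have := hS.epi_g
  have hp : S.f ≫ S.g = f ≫ 0 := by simp
  have hi : Mono i := (MorphismProperty.monomorphisms A).of_isPushout sq.flip
    (MorphismProperty.monomorphisms.infer_property _)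
  have hepi : Epi (sq.desc S.g 0 hp) := by
    have : Epi (g ≫ sq.desc S.g 0 hp) := by rw [sq.inl_desc]; infer_instance
    exact epi_of_epi g _
  refine ⟨sq.desc S.g 0 hp, sq.inr_desc _ _ _, sq.inl_desc _ _ _, ?_⟩
  refine { exact := ?_, mono_f := hi, epi_g := hepi }
  refine ShortComplex.exact_of_g_is_cokernel _
    (CokernelCofork.IsColimit.ofπ' _ _ (fun {T} a ha => ?_))
  have h0 : S.f ≫ (g ≫ a) = 0 := by
    have ha' : i ≫ a = 0 := ha
    rw [reassoc_of% sq.w, ha', comp_zero]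
  refine ⟨hS.exact.desc (g ≫ a) h0, ?_⟩
  apply sq.hom_ext
  · rw [sq.inl_desc_assoc, hS.exact.g_desc]
  · have ha' : i ≫ a = 0 := ha
    rw [sq.inr_desc_assoc, zero_comp, ha']

lemma pullback_shortExact {S : ShortComplex A} (hS : S.ShortExact) {Y E : A} {f : Y ⟶ S.X₃}
    {g : E ⟶ S.X₂} {p : E ⟶ Y} (sq : IsPullback g p S.g f) :
    ∃ (i : S.X₁ ⟶ E) (hw : i ≫ p = 0), i ≫ g = S.f ∧ (ShortComplex.mk i p hw).ShortExact := by
  have := hS.mono_f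
  have := hS.epi_g
  have hp : S.f ≫ S.g = 0 ≫ f := by simp
  have hi : Epi p := Abelian.epi_snd_of_isLimit _ _ sq.isLimit
  have hmono : Mono (sq.lift S.f 0 hp) := by
    have : Mono (sq.lift S.f 0 hp ≫ g) := by rw [sq.lift_fst]; infer_instance
    exact mono_of_mono _ g
  refine ⟨sq.lift S.f 0 hp, sq.lift_snd _ _ _, sq.lift_fst _ _ _, ?_⟩
  refine { exact := ?_, mono_f := hmono, epi_g := hi }
  refine ShortComplex.exact_of_f_is_kernel _
    (KernelFork.IsLimit.ofι' _ _ (fun {T} a ha => ?_))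
  have ha' : a ≫ p = 0 := ha
  have h0 : (a ≫ g) ≫ S.g = 0 := by
    rw [Category.assoc, sq.w, reassoc_of% ha', zero_comp]
  refine ⟨hS.exact.lift (a ≫ g) h0, ?_⟩
  apply sq.hom_ext
  · rw [Category.assoc, sq.lift_fst, hS.exact.lift_f]
  · rw [Category.assoc, sq.lift_snd, comp_zero, ha']


noncomputable abbrev kerSeq {n : ℕ} {X Y : A} (s : ExtSeq A n X Y) (k : ℕ) : ShortComplex A :=
  ShortComplex.mk (kernel.ι (s.d (k + 1))) (kernel.lift (s.d k) (s.d (k + 1)) (s.w k))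
    (by rw [← cancel_mono (kernel.ι _)]; simp)

lemma kerSeq_shortExact {n : ℕ} {X Y : A} (s : ExtSeq A n X Y) (k : ℕ) :
    (kerSeq s k).ShortExact := by
  have : Epi (kerSeq s k).g := (s.ex k).epi_kernelLift
  have : Mono (kerSeq s k).f := by dsimp [kerSeq]; infer_instance
  refine { exact := ?_ }
  refine ShortComplex.exact_of_f_is_kernel _ (KernelFork.IsLimit.ofι' _ _ (fun {T} a ha => ?_))
  refine ⟨kernel.lift _ a ?_, kernel.lift_ι _ _ _⟩
  have := congr($ha ≫ kernel.ι (s.d k))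
  simpa using this

noncomputable abbrev botSeq {n : ℕ} {X Y : A} (s : ExtSeq A n X Y) : ShortComplex A :=
  ShortComplex.mk (kernel.ι (s.d 0)) (s.d 0) (by simp)

lemma botSeq_shortExact {n : ℕ} {X Y : A} (s : ExtSeq A n X Y) :
    (botSeq s).ShortExact := by
  have : Epi (botSeq s).g := s.epi0
  have : Mono (botSeq s).f := by dsimp [botSeq]; infer_instance
  exact { exact := ShortComplex.exact_of_f_is_kernel _ (kernelIsKernel _) }

variable [HasExt.{w} A]

lemma natural_step {S₁ S₂ : ShortComplex A} (h₁ : S₁.ShortExact) (h₂ : S₂.ShortExact)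
    (f : S₁ ⟶ S₂) {X X' : A} {k k' m : ℕ} (hm : k' + k = m) (a : Ext X X' k')
    (α : Ext X S₁.X₃ m) (β : Ext X' S₂.X₃ k)
    (ih : α.comp (Ext.mk₀ f.τ₃) (add_zero _) = a.comp β hm) :
    (α.comp h₁.extClass rfl).comp (Ext.mk₀ f.τ₁) (add_zero _) =
      a.comp (β.comp h₂.extClass rfl) (by lia) := by
  rw [Ext.comp_assoc_of_third_deg_zero,
    ShortComplex.ShortExact.extClass_naturality h₁ h₂ f,
    ← Ext.comp_assoc_of_second_deg_zero, ih, Ext.comp_assoc]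
  lia

/-- class of the truncated extension -/
noncomputable def cls {n : ℕ} {X Y : A} (s : ExtSeq A n X Y) :
    ∀ k : ℕ, Ext (s.ob 0) (kernel (s.d k)) (k + 1)
  | 0 => (botSeq_shortExact s).extClass
  | k + 1 => (cls s k).comp (kerSeq_shortExact s k).extClass rfl

/-- the map on kernels of a morphism of sequences -/
noncomputable def kmap {n : ℕ} {X Y : A} {s t : ExtSeq A n X Y} (f : ExtSeqHom s t) (k : ℕ) :
    kernel (s.d k) ⟶ kernel (t.d k) :=
  kernel.map _ _ (f.φ (k + 1)) (f.φ k) (f.comm k)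

lemma cls_naturality {n : ℕ} {X Y : A} {s t : ExtSeq A n X Y} (f : ExtSeqHom s t) (k : ℕ) :
    (cls s k).comp (Ext.mk₀ (kmap f k)) (add_zero _) =
      (Ext.mk₀ (f.φ 0)).comp (cls t k) (zero_add _) := by
  induction k with
  | zero =>
    exact ShortComplex.ShortExact.extClass_naturality (botSeq_shortExact s) (botSeq_shortExact t)
      { τ₁ := kmap f 0, τ₂ := f.φ 1, τ₃ := f.φ 0
        comm₁₂ := by simp [botSeq, kmap]
        comm₂₃ := (f.comm 0).symm }
  | succ k ih =>
    exact natural_step (kerSeq_shortExact s k) (kerSeq_shortExact t k)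
      { τ₁ := kmap f (k + 1), τ₂ := f.φ (k + 2), τ₃ := kmap f k
        comm₁₂ := by simp [kmap]
        comm₂₃ := by
          rw [← cancel_mono (kernel.ι _)]
          simp [kmap, (f.comm (k+1))] } (zero_add _) (Ext.mk₀ (f.φ 0)) _ _ ih

/-- the top map -/
lemma top_iso {n : ℕ} {X Y : A} (s : ExtSeq A (n + 1) X Y) :
    IsIso (kernel.lift (s.d n) (s.d (n + 1)) (s.w n)) := by
  have : Epi (kernel.lift (s.d n) (s.d (n + 1)) (s.w n)) := (s.ex n).epi_kernelLift
  have : Mono (s.d (n + 1)) :=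
    (s.ex (n + 1)).mono_g ((s.is_zero (n + 3) (by lia)).eq_of_src _ _)
  have : Mono (kernel.lift (s.d n) (s.d (n + 1)) (s.w n)) := by
    infer_instance
  exact isIso_of_mono_of_epi _

noncomputable def topMap {n : ℕ} {X Y : A} (s : ExtSeq A (n + 1) X Y) : kernel (s.d n) ⟶ Y :=
  haveI := top_iso s
  inv (kernel.lift (s.d n) (s.d (n + 1)) (s.w n)) ≫ s.isoTop.hom

/-- the class of an extension -/
noncomputable def eclass {n : ℕ} {X Y : A} (s : ExtSeq A (n + 1) X Y) : Ext X Y (n + 1) :=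
  (Ext.mk₀ s.iso0.inv).comp ((cls s n).comp (Ext.mk₀ (topMap s)) (add_zero _)) (zero_add _)

lemma topMap_naturality {n : ℕ} {X Y : A} {s t : ExtSeq A (n + 1) X Y} (f : ExtSeqHom s t) :
    kmap f n ≫ topMap t = topMap s := by
  have := top_iso s
  have := top_iso t
  rw [← cancel_epi (kernel.lift (s.d n) (s.d (n + 1)) (s.w n))]
  have h : kernel.lift (s.d n) (s.d (n + 1)) (s.w n) ≫ kmap f n =
      f.φ (n + 2) ≫ kernel.lift (t.d n) (t.d (n + 1)) (t.w n) := by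
    rw [← cancel_mono (kernel.ι _)]
    simp [kmap, f.comm]
  rw [reassoc_of% h]
  simp [topMap, f.φTop]

lemma eclass_eq_of_hom {n : ℕ} {X Y : A} {s t : ExtSeq A (n + 1) X Y} (f : ExtSeqHom s t) :
    eclass s = eclass t := by
  have h := cls_naturality f n
  unfold eclass
  rw [← topMap_naturality f, ← Ext.mk₀_comp_mk₀, ← Ext.comp_assoc_of_third_deg_zero (cls s n), h,
    f.φ0]
  rw [Ext.comp_assoc_of_third_deg_zero,
     Ext.mk₀_comp_mk₀_assoc]
  simp

lemma eclass_eq {n : ℕ} {X Y : A} {s t : ExtSeq A (n + 1) X Y} (h : YonedaEquiv s t) :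
    eclass s = eclass t := by
  induction h with
  | rel x y h => exact eclass_eq_of_hom h.some
  | refl x => rfl
  | symm x y _ ih => exact ih.symm
  | trans x y z _ _ h1 h2 => exact h1.trans h2

lemma exists_comp {X Y : A} {n : ℕ} (e : Ext X Y (n + 1)) :
    ∃ (K P : A) (i : K ⟶ P) (p : P ⟶ X) (hw : i ≫ p = 0)
      (hS : (ShortComplex.mk i p hw).ShortExact) (f : Ext K Y n),
      hS.extClass.comp f (add_comm 1 n) = e := by
  obtain ⟨P, p, hp, h⟩ := efface e
  let S := ShortComplex.mk _ _ (kernel.condition p)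
  have hS : S.ShortExact :=
      { exact := ShortComplex.exact_of_f_is_kernel _ (kernelIsKernel S.g) }
  obtain ⟨f, hf⟩ := Ext.contravariant_sequence_exact₃ hS Y e h (add_comm 1 n)
  exact ⟨_, _, _, _, _, hS, f, hf⟩

open ZeroObject in
/-- objects of the trivial sequence -/
noncomputable def trivOb (X : A) : ℕ → A
  | 0 => X
  | 1 => X
  | _ + 2 => 0

/-- differentials of the trivial sequence -/
noncomputable def trivD (X : A) : ∀ i, trivOb X (i + 1) ⟶ trivOb X i
  | 0 => 𝟙 X
  | _ + 1 => 0

/-- trivial extension `X = X` of length zero -/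
noncomputable def triv (X : A) : ExtSeq A 0 X X where
  ob := trivOb X
  d := trivD X
  iso0 := Iso.refl X
  isoTop := Iso.refl X
  is_zero i hi := by
    obtain ⟨j, rfl⟩ : ∃ j, i = j + 2 := ⟨i - 2, by lia⟩
    exact isZero_zero A
  w i := by simp [trivD]
  ex i := by
    cases i with
    | zero =>
      rw [ShortComplex.exact_iff_mono _ (by simp [trivD])]
      exact inferInstanceAs (Mono (𝟙 X))
    | succ i => exact ShortComplex.exact_of_isZero_X₂ _ (isZero_zero A)
  epi0 := inferInstanceAs (Epi (𝟙 X))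

section Cons

variable {S : ShortComplex A} (hS : S.ShortExact) {n : ℕ} {Y : A} (s : ExtSeq A n S.X₁ Y)

/-- objects -/
def consOb {S : ShortComplex A} {n : ℕ} {Y : A} (s : ExtSeq A n S.X₁ Y) : ℕ → A
  | 0 => S.X₃
  | 1 => S.X₂
  | i + 2 => s.ob (i + 1)

/-- differentials -/
noncomputable def consD {S : ShortComplex A} {n : ℕ} {Y : A} (s : ExtSeq A n S.X₁ Y) :
    ∀ i, consOb s (i + 1) ⟶ consOb s i
  | 0 => S.g
  | 1 => s.d 0 ≫ s.iso0.hom ≫ S.f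
  | i + 2 => s.d (i + 1)

lemma consD_w {S : ShortComplex A} {n : ℕ} {Y : A} (s : ExtSeq A n S.X₁ Y) (i : ℕ) :
    consD s (i + 1) ≫ consD s i = 0 := by
  match i with
  | 0 => exact show (s.d 0 ≫ s.iso0.hom ≫ S.f) ≫ S.g = 0 by simp
  | 1 => exact show s.d 1 ≫ (s.d 0 ≫ s.iso0.hom ≫ S.f) = 0 by simp [reassoc_of% s.w 0]
  | i + 2 => exact s.w (i + 1)

/-- splicing with a short exact sequence -/
noncomputable def cons : ExtSeq A (n + 1) S.X₃ Y where
  ob := consOb s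
  d := consD s
  iso0 := Iso.refl _
  isoTop := s.isoTop
  is_zero i hi := by
    obtain ⟨j, rfl⟩ : ∃ j, i = j + 2 := ⟨i - 2, by lia⟩
    exact s.is_zero (j + 1) (by lia)
  w := consD_w s
  ex i := by
    have := s.epi0
    have := hS.mono_f
    match i with
    | 0 =>
      let φ : ShortComplex.mk _ _ (consD_w s 0) ⟶ S :=
        { τ₁ := s.d 0 ≫ s.iso0.hom, τ₂ := 𝟙 S.X₂, τ₃ := 𝟙 S.X₃
          comm₁₂ := by
            exact show (s.d 0 ≫ s.iso0.hom) ≫ S.f = (s.d 0 ≫ s.iso0.hom ≫ S.f) ≫ 𝟙 S.X₂ by simp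
          comm₂₃ := by exact show 𝟙 S.X₂ ≫ S.g = S.g ≫ 𝟙 S.X₃ by simp }
      have : Epi φ.τ₁ := inferInstanceAs (Epi (s.d 0 ≫ s.iso0.hom))
      have : IsIso φ.τ₂ := inferInstanceAs (IsIso (𝟙 _))
      have : Mono φ.τ₃ := inferInstanceAs (Mono (𝟙 _))
      exact (ShortComplex.exact_iff_of_epi_of_isIso_of_mono φ).2 hS.exact
    | 1 =>
      let φ : ShortComplex.mk _ _ (s.w 0) ⟶ ShortComplex.mk _ _ (consD_w s 1) :=
        { τ₁ := 𝟙 (s.ob 2), τ₂ := 𝟙 (s.ob 1), τ₃ := s.iso0.hom ≫ S.f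
          comm₁₂ := by exact show 𝟙 (s.ob 2) ≫ s.d 1 = s.d 1 ≫ 𝟙 (s.ob 1) by simp
          comm₂₃ := by
            exact show 𝟙 (s.ob 1) ≫ s.d 0 ≫ s.iso0.hom ≫ S.f = s.d 0 ≫ s.iso0.hom ≫ S.f by simp }
      have : Epi φ.τ₁ := inferInstanceAs (Epi (𝟙 _))
      have : IsIso φ.τ₂ := inferInstanceAs (IsIso (𝟙 _))
      have : Mono φ.τ₃ := inferInstanceAs (Mono (s.iso0.hom ≫ S.f))
      exact (ShortComplex.exact_iff_of_epi_of_isIso_of_mono φ).1 (s.ex 0)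
    | i + 2 => exact s.ex (i + 1)
  epi0 := hS.epi_g

end Cons

/-- comparison data between a sequence and its splice with a short exact sequence -/
structure Cmp {S : ShortComplex A} {n : ℕ} {Y : A} (s : ExtSeq A n S.X₁ Y)
    (t : ExtSeq A (n + 1) S.X₃ Y) where
  a : S.X₃ ⟶ t.ob 0
  b : S.X₂ ⟶ t.ob 1
  φ : ∀ k, s.ob (k + 1) ⟶ t.ob (k + 2)
  h0 : b ≫ t.d 0 = S.g ≫ a
  h1 : φ 0 ≫ t.d 1 = s.d 0 ≫ s.iso0.hom ≫ S.f ≫ b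
  h2 : ∀ k, φ (k + 1) ≫ t.d (k + 2) = s.d (k + 1) ≫ φ k
  htop : φ n ≫ t.isoTop.hom = s.isoTop.hom
  ha : a ≫ t.iso0.hom = 𝟙 S.X₃

section Cmp

variable {S : ShortComplex A} (hS : S.ShortExact) {n : ℕ} {Y : A} {s : ExtSeq A n S.X₁ Y}
  {t : ExtSeq A (n + 1) S.X₃ Y} (c : Cmp s t)

lemma Cmp.a_eq : t.iso0.inv = c.a := by
  rw [← cancel_mono t.iso0.hom, c.ha, Iso.inv_hom_id]

lemma Cmp.km_w (k : ℕ) : (kernel.ι (s.d k) ≫ c.φ k) ≫ t.d (k + 1) = 0 := by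
  match k with
  | 0 => rw [Category.assoc, c.h1, kernel.condition_assoc, zero_comp]
  | k + 1 => rw [Category.assoc, c.h2, kernel.condition_assoc, zero_comp]

/-- comparison of kernels -/
noncomputable def km (k : ℕ) : kernel (s.d k) ⟶ kernel (t.d (k + 1)) :=
  kernel.lift (t.d (k + 1)) (kernel.ι (s.d k) ≫ c.φ k) (c.km_w k)

/-- comparison of kernels at the bottom -/
noncomputable def k0 : S.X₁ ⟶ kernel (t.d 0) :=
  kernel.lift (t.d 0) (S.f ≫ c.b) (by rw [Category.assoc, c.h0, S.zero_assoc, zero_comp])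

lemma bot_cmp : hS.extClass.comp (Ext.mk₀ (k0 c)) (add_zero _) =
    (Ext.mk₀ c.a).comp (cls t 0) (zero_add _) :=
  ShortComplex.ShortExact.extClass_naturality hS (botSeq_shortExact t)
    { τ₁ := k0 c, τ₂ := c.b, τ₃ := c.a
      comm₁₂ := by simp [k0]
      comm₂₃ := c.h0 }

/-- the left hand side -/
noncomputable def gam (s : ExtSeq A n S.X₁ Y) (k : ℕ) : Ext S.X₃ (kernel (s.d k)) (k + 1 + 1) :=
  (hS.extClass.comp (Ext.mk₀ s.iso0.inv) (add_zero _)).comp (cls s k) (add_comm 1 (k + 1))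

lemma cls_cmp (k : ℕ) : (gam hS s k).comp (Ext.mk₀ (km c k)) (add_zero _) =
    (Ext.mk₀ c.a).comp (cls t (k + 1)) (zero_add _) := by
  induction k with
  | zero =>
    exact natural_step (botSeq_shortExact s) (kerSeq_shortExact t 0)
      { τ₁ := km c 0, τ₂ := c.φ 0, τ₃ := s.iso0.hom ≫ k0 c
        comm₁₂ := by simp [km]
        comm₂₃ := by
          rw [← cancel_mono (kernel.ι _)]
          simp [k0, c.h1] } (k' := 0) (zero_add 1) (Ext.mk₀ c.a)
      (hS.extClass.comp (Ext.mk₀ s.iso0.inv) (add_zero _))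
      (cls t 0) (by
        rw [Ext.comp_assoc_of_third_deg_zero, Ext.mk₀_comp_mk₀, Iso.inv_hom_id_assoc,
          bot_cmp])
  | succ k ih =>
    have h := natural_step (kerSeq_shortExact s k) (kerSeq_shortExact t (k + 1))
      { τ₁ := km c (k + 1), τ₂ := c.φ (k + 1), τ₃ := km c k
        comm₁₂ := by simp [km]
        comm₂₃ := by
          rw [← cancel_mono (kernel.ι _)]
          simp [km, c.h2] } (k' := 0) (zero_add _) (Ext.mk₀ c.a)
      (gam hS s k)
      (cls t (k + 1)) ih
    refine Eq.trans ?_ h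
    congr 1
    exact (Ext.comp_assoc (hS.extClass.comp (Ext.mk₀ s.iso0.inv) (add_zero _)) (cls s k)
      (kerSeq_shortExact s k).extClass (add_comm 1 (k + 1)) rfl (by lia)).symm

end Cmp

lemma eclass_cmp {S : ShortComplex A} (hS : S.ShortExact) {n : ℕ} {Y : A}
    {s : ExtSeq A (n + 1) S.X₁ Y} {t : ExtSeq A (n + 2) S.X₃ Y} (c : Cmp s t) :
    eclass t = hS.extClass.comp (eclass s) (add_comm 1 (n + 1)) := by
  have ht : km c n ≫ topMap t = topMap s := by
    have := top_iso s
    have := top_iso t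
    rw [← cancel_epi (kernel.lift (s.d n) (s.d (n + 1)) (s.w n))]
    have h : kernel.lift (s.d n) (s.d (n + 1)) (s.w n) ≫ km c n =
        c.φ (n + 1) ≫ kernel.lift (t.d (n + 1)) (t.d (n + 2)) (t.w (n + 1)) := by
      rw [← cancel_mono (kernel.ι _)]
      simp [km, c.h2]
    rw [reassoc_of% h]
    simp [topMap, c.htop]
  have h := cls_cmp hS c n
  unfold eclass
  rw [c.a_eq, ← Ext.comp_assoc_of_third_deg_zero, ← h, Ext.comp_assoc_of_third_deg_zero,
    Ext.mk₀_comp_mk₀, ht, gam]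
  rw [Ext.comp_assoc_of_second_deg_zero, Ext.comp_assoc_of_third_deg_zero,
    Ext.comp_assoc_of_third_deg_zero]

lemma eclass_base {S : ShortComplex A} (hS : S.ShortExact)
    {t : ExtSeq A 1 S.X₃ S.X₁} {s : ExtSeq A 0 S.X₁ S.X₁} (c : Cmp s t)
    (f : S.X₁ ⟶ t.ob 2) (hf : f ≫ t.d 1 = S.f ≫ c.b) (hf' : f ≫ t.isoTop.hom = 𝟙 _) :
    eclass t = hS.extClass := by
  have ht : k0 c ≫ topMap t = 𝟙 _ := by
    have := top_iso t
    have h : k0 c = f ≫ kernel.lift (t.d 0) (t.d 1) (t.w 0) := by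
      rw [← cancel_mono (kernel.ι _)]
      simp [k0, hf]
    rw [h]
    simpa [topMap] using hf'
  have h := bot_cmp hS c
  unfold eclass
  rw [c.a_eq, ← Ext.comp_assoc_of_third_deg_zero, ← h, Ext.comp_assoc_of_third_deg_zero,
    Ext.mk₀_comp_mk₀, ht, Ext.comp_mk₀_id]

/-- comparison with cons -/
noncomputable def consCmp {S : ShortComplex A} (hS : S.ShortExact) {n : ℕ} {Y : A}
    (s : ExtSeq A n S.X₁ Y) : Cmp s (cons hS s) where
  a := 𝟙 S.X₃
  b := 𝟙 S.X₂
  φ k := 𝟙 (s.ob (k + 1))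
  h0 := by exact show 𝟙 S.X₂ ≫ S.g = S.g ≫ 𝟙 S.X₃ by simp
  h1 := by
    exact show 𝟙 (s.ob 1) ≫ (s.d 0 ≫ s.iso0.hom ≫ S.f) =
      s.d 0 ≫ s.iso0.hom ≫ S.f ≫ 𝟙 S.X₂ by simp
  h2 k := by exact show 𝟙 (s.ob (k + 2)) ≫ s.d (k + 1) = s.d (k + 1) ≫ 𝟙 (s.ob (k + 1)) by simp
  htop := by exact show 𝟙 (s.ob (n + 1)) ≫ s.isoTop.hom = s.isoTop.hom by simp
  ha := by exact show 𝟙 S.X₃ ≫ 𝟙 S.X₃ = 𝟙 S.X₃ by simp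

lemma eclass_cons {S : ShortComplex A} (hS : S.ShortExact) {n : ℕ} {Y : A}
    (s : ExtSeq A (n + 1) S.X₁ Y) :
    eclass (cons hS s) = hS.extClass.comp (eclass s) (add_comm 1 (n + 1)) :=
  eclass_cmp hS (consCmp hS s)

lemma eclass_cons_triv {S : ShortComplex A} (hS : S.ShortExact) :
    eclass (cons hS (triv S.X₁)) = hS.extClass :=
  eclass_base hS (consCmp hS (triv S.X₁)) (𝟙 S.X₁)
    (by exact show 𝟙 S.X₁ ≫ (𝟙 S.X₁ ≫ 𝟙 S.X₁ ≫ S.f) = S.f ≫ 𝟙 S.X₂ by simp)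
    (by exact show 𝟙 S.X₁ ≫ 𝟙 S.X₁ = 𝟙 S.X₁ by simp)


lemma eclass_surj {n : ℕ} {X Y : A} (e : Ext X Y (n + 1)) :
    ∃ s : ExtSeq A (n + 1) X Y, eclass s = e := by
  induction n generalizing X with
  | zero =>
    obtain ⟨K, P, i, p, hw, hS, f, rfl⟩ := exists_comp e
    obtain ⟨f, rfl⟩ := (Ext.mk₀_bijective K Y).2 f
    obtain ⟨q, hq, h1, hT⟩ := pushout_shortExact hS (IsPushout.of_hasPushout i f)
    refine ⟨cons hT (triv Y), ?_⟩
    refine (eclass_cons_triv hT).trans ?_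
    have := ShortComplex.ShortExact.extClass_naturality hS hT
      { τ₁ := f, τ₂ := pushout.inl i f, τ₃ := 𝟙 X
        comm₁₂ := pushout.condition.symm
        comm₂₃ := by simpa using h1 }
    rw [Ext.mk₀_id_comp] at this
    exact this.symm
  | succ n ih =>
    obtain ⟨K, P, i, p, hw, hS, f, rfl⟩ := exists_comp e
    obtain ⟨s, rfl⟩ := ih f
    exact ⟨cons hS s, eclass_cons hS s⟩

lemma subsingleton_ext {n : ℕ} (hn : 0 < n) {X Y : A} (h : extVanish A n X Y) :
    Subsingleton (Ext X Y n) := by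
  obtain ⟨n, rfl⟩ : ∃ m, n = m + 1 := ⟨n - 1, by lia⟩
  refine ⟨fun a b => ?_⟩
  obtain ⟨s, rfl⟩ := eclass_surj a
  obtain ⟨t, rfl⟩ := eclass_surj b
  exact eclass_eq (h s t)

end DWide

namespace DWide
open Abelian

lemma resSet_iso {𝒲 : Set A} (j : ℕ) {X Y : A} (e : X ≅ Y) (h : X ∈ resSet A 𝒲 j) :
    Y ∈ resSet A 𝒲 j := by
  induction j generalizing X Y with
  | zero => exact IsZero.of_iso h e.symm
  | succ j ih =>
    obtain ⟨V, f, hV, hf, hk⟩ := h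
    exact ⟨V, f ≫ e.hom, hV, inferInstance, ih (kernelCompMono f e.hom).symm hk⟩

lemma coresSet_iso {𝒲 : Set A} (j : ℕ) {X Y : A} (e : X ≅ Y) (h : X ∈ coresSet A 𝒲 j) :
    Y ∈ coresSet A 𝒲 j := by
  induction j generalizing X Y with
  | zero => exact IsZero.of_iso h e.symm
  | succ j ih =>
    obtain ⟨V, f, hV, hf, hk⟩ := h
    exact ⟨V, e.inv ≫ f, hV, inferInstance, ih (cokernelEpiComp e.inv f).symm hk⟩

lemma kerShort {X Y : A} (f : X ⟶ Y) [Epi f] :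
    (ShortComplex.mk (kernel.ι f) f (kernel.condition f)).ShortExact :=
  { exact := ShortComplex.exact_of_f_is_kernel _ (kernelIsKernel f) }

lemma cokerShort {X Y : A} (f : X ⟶ Y) [Mono f] :
    (ShortComplex.mk f (cokernel.π f) (cokernel.condition f)).ShortExact :=
  { exact := ShortComplex.exact_of_g_is_cokernel _ (cokernelIsCokernel f) }

lemma vanish_res [HasExt.{w} A] {𝒲 : Set A} {d : ℕ} {M : A}
    (hv : ∀ W ∈ 𝒲, ∀ i, 0 < i → i < d → Subsingleton (Ext M W i)) (j : ℕ) :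
    ∀ K ∈ resSet A 𝒲 j, ∀ i, 0 < i → i + j ≤ d → Subsingleton (Ext M K i) := by
  induction j with
  | zero =>
    intro K hK i _ _
    refine ⟨fun a b => ?_⟩
    have h : 𝟙 K = 0 := (IsZero.iff_id_eq_zero K).1 hK
    rw [← Ext.comp_mk₀_id a, ← Ext.comp_mk₀_id b, h]
    simp
  | succ j ih =>
    rintro K ⟨V, f, hV, hf, hk⟩ i hi hij
    have h1 := hv V hV i hi (by lia)
    have h2 := ih _ hk (i + 1) (by lia) (by lia)
    have key : ∀ a : Ext M K i, a = 0 := by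
      intro a
      obtain ⟨x, rfl⟩ := Ext.covariant_sequence_exact₃ M (kerShort f) a rfl
        (@Subsingleton.elim _ h2 _ _)
      rw [@Subsingleton.elim _ h1 x 0, Ext.zero_comp]
    exact ⟨fun a b => (key a).trans (key b).symm⟩

lemma vanish_cores [HasExt.{w} A] {𝒲 : Set A} {d : ℕ} {M : A}
    (hv : ∀ W ∈ 𝒲, ∀ i, 0 < i → i < d → Subsingleton (Ext W M i)) (j : ℕ) :
    ∀ K ∈ coresSet A 𝒲 j, ∀ i, 0 < i → i + j ≤ d → Subsingleton (Ext K M i) := by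
  induction j with
  | zero =>
    intro K hK i _ _
    refine ⟨fun a b => ?_⟩
    have h : 𝟙 K = 0 := (IsZero.iff_id_eq_zero K).1 hK
    rw [← Ext.mk₀_id_comp a, ← Ext.mk₀_id_comp b, h]
    simp
  | succ j ih =>
    rintro K ⟨V, f, hV, hf, hk⟩ i hi hij
    have h1 := hv V hV i hi (by lia)
    have h2 := ih _ hk (1 + i) (by lia) (by lia)
    have key : ∀ a : Ext K M i, a = 0 := by
      intro a
      obtain ⟨x, rfl⟩ := Ext.contravariant_sequence_exact₁ (cokerShort f) M a rfl
        (@Subsingleton.elim _ h2 _ _)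
      rw [@Subsingleton.elim _ h1 x 0, Ext.comp_zero]
    exact ⟨fun a b => (key a).trans (key b).symm⟩

lemma lift_of_ext [HasExt.{w} A] {S : ShortComplex A} (hS : S.ShortExact) {M : A}
    (h : Subsingleton (Ext M S.X₁ 1)) (g : M ⟶ S.X₃) : ∃ l : M ⟶ S.X₂, l ≫ S.g = g := by
  obtain ⟨x, hx⟩ := Ext.covariant_sequence_exact₃ M hS (Ext.mk₀ g) (zero_add 1)
        (@Subsingleton.elim _ h _ _)
  obtain ⟨x, rfl⟩ := (Ext.mk₀_bijective _ _).2 x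
  rw [Ext.mk₀_comp_mk₀] at hx
  exact ⟨x, (Ext.mk₀_bijective _ _).1 hx⟩

lemma extend_of_ext [HasExt.{w} A] {S : ShortComplex A} (hS : S.ShortExact) {M : A}
    (h : Subsingleton (Ext S.X₃ M 1)) (g : S.X₁ ⟶ M) : ∃ l : S.X₂ ⟶ M, S.f ≫ l = g := by
  obtain ⟨x, hx⟩ := Ext.contravariant_sequence_exact₁ hS M (Ext.mk₀ g) (add_zero 1)
        (@Subsingleton.elim _ h _ _)
  obtain ⟨x, rfl⟩ := (Ext.mk₀_bijective _ _).2 x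
  rw [Ext.mk₀_comp_mk₀] at hx
  exact ⟨x, (Ext.mk₀_bijective _ _).1 hx⟩

/-- the properties used in the main argument -/
structure Data (𝒲 : Set A) (j : ℕ) : Prop where
  zero : ∀ Z : A, IsZero Z → Z ∈ 𝒲
  add : ∀ X Y : A, X ∈ 𝒲 → Y ∈ 𝒲 → (X ⊞ Y) ∈ 𝒲
  ker : ∀ X ∈ 𝒲, ∀ Y ∈ 𝒲, ∀ f : X ⟶ Y, kernel f ∈ resSet A 𝒲 (j + 1)
  coker : ∀ X ∈ 𝒲, ∀ Y ∈ 𝒲, ∀ f : X ⟶ Y, cokernel f ∈ coresSet A 𝒲 (j + 1)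
  lift : ∀ M ∈ 𝒲, ∀ (V X : A) (f : V ⟶ X), Epi f → kernel f ∈ resSet A 𝒲 j →
    ∀ g : M ⟶ X, ∃ h : M ⟶ V, h ≫ f = g
  extend : ∀ M ∈ 𝒲, ∀ (V X : A) (f : X ⟶ V), Mono f → cokernel f ∈ coresSet A 𝒲 j →
    ∀ g : X ⟶ M, ∃ h : V ⟶ M, f ≫ h = g
  ext : ∀ S : ShortComplex A, S.ShortExact → S.X₁ ∈ 𝒲 → S.X₃ ∈ 𝒲 → S.X₂ ∈ 𝒲

namespace Data

variable {𝒲 : Set A} {j : ℕ}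

lemma cover (D : Data 𝒲 j) {i : ℕ} {K : A} (hK : K ∈ resSet A 𝒲 i) : ∃ V ∈ 𝒲, ∃ r : V ⟶ K, Epi r := by
  cases i with
  | zero => exact ⟨K, D.zero _ hK, 𝟙 K, inferInstance⟩
  | succ i =>
    obtain ⟨V, f, hV, hf, _⟩ := hK
    exact ⟨V, hV, f, hf⟩

lemma hull (D : Data 𝒲 j) {i : ℕ} {K : A} (hK : K ∈ coresSet A 𝒲 i) : ∃ V ∈ 𝒲, ∃ r : K ⟶ V, Mono r := by
  cases i with
  | zero => exact ⟨K, D.zero _ hK, 𝟙 K, inferInstance⟩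
  | succ i =>
    obtain ⟨V, f, hV, hf, _⟩ := hK
    exact ⟨V, hV, f, hf⟩

lemma coker_mem (D : Data 𝒲 j) {X Y : A} (hX : X ∈ resSet A 𝒲 (j + 1)) (hY : Y ∈ resSet A 𝒲 (j + 1))
    (f : X ⟶ Y) : cokernel f ∈ coresSet A 𝒲 (j + 1) := by
  obtain ⟨V, hV, p, hp⟩ := D.cover hX
  obtain ⟨V₁, q, hV₁, hq, hk⟩ := hY
  obtain ⟨V', hV', r, hr⟩ := D.cover hk
  obtain ⟨h, hh⟩ := D.lift V hV V₁ Y q hq hk (p ≫ f)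
  have w : biprod.desc (r ≫ kernel.ι q) h ≫ (q ≫ cokernel.π f) = 0 := by
    ext
    · simp
    · simp [reassoc_of% hh]
  have hc : IsColimit (CokernelCofork.ofπ (f := biprod.desc (r ≫ kernel.ι q) h)
      (q ≫ cokernel.π f) w) := by
    refine CokernelCofork.IsColimit.ofπ' _ _ (fun {T} a ha => ?_)
    have h1 : kernel.ι q ≫ a = 0 := by
      rw [← cancel_epi r]
      simpa using congr(biprod.inl ≫ $ha)
    have h2 : h ≫ a = 0 := by simpa using congr(biprod.inr ≫ $ha)
    let a' : Y ⟶ T := (kerShort q).exact.desc a h1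
    have ha' : q ≫ a' = a := (kerShort q).exact.g_desc a h1
    have h3 : f ≫ a' = 0 := by
      rw [← cancel_epi p, comp_zero, ← Category.assoc, ← hh, Category.assoc, ha', h2]
    exact ⟨cokernel.desc f a' h3, by simp [ha']⟩
  exact coresSet_iso _ ((cokernelIsCokernel (biprod.desc (r ≫ kernel.ι q) h)).coconePointUniqueUpToIso hc)
    (D.coker _ (D.add _ _ hV' hV) _ hV₁ _)

lemma ker_mem (D : Data 𝒲 j) {X Y : A} (hX : X ∈ coresSet A 𝒲 (j + 1)) (hY : Y ∈ coresSet A 𝒲 (j + 1))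
    (f : X ⟶ Y) : kernel f ∈ resSet A 𝒲 (j + 1) := by
  obtain ⟨V, hV, p, hp⟩ := D.hull hY
  obtain ⟨V₁, q, hV₁, hq, hk⟩ := hX
  obtain ⟨V', hV', r, hr⟩ := D.hull hk
  obtain ⟨h, hh⟩ := D.extend V hV V₁ X q hq hk (f ≫ p)
  have w : (kernel.ι f ≫ q) ≫ biprod.lift (cokernel.π q ≫ r) h = 0 := by
    ext
    · simp
    · simp [hh]
  have hc : IsLimit (KernelFork.ofι (f := biprod.lift (cokernel.π q ≫ r) h)
      (kernel.ι f ≫ q) w) := by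
    refine KernelFork.IsLimit.ofι' _ _ (fun {T} a ha => ?_)
    have h1 : a ≫ cokernel.π q = 0 := by
      rw [← cancel_mono r]
      simpa using congr($ha ≫ biprod.fst)
    have h2 : a ≫ h = 0 := by simpa using congr($ha ≫ biprod.snd)
    let a' : T ⟶ X := (cokerShort q).exact.lift a h1
    have ha' : a' ≫ q = a := (cokerShort q).exact.lift_f a h1
    have h3 : a' ≫ f = 0 := by
      rw [← cancel_mono p, zero_comp, Category.assoc, ← hh, ← Category.assoc, ha', h2]
    exact ⟨kernel.lift f a' h3, by simp [ha']⟩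
  exact resSet_iso _
    ((kernelIsKernel (biprod.lift (cokernel.π q ≫ r) h)).conePointUniqueUpToIso hc)
    (D.ker _ hV₁ _ (D.add _ _ hV' hV) _)

lemma zero_res (D : Data 𝒲 j) (i : ℕ) {Z : A} (hZ : IsZero Z) : Z ∈ resSet A 𝒲 i := by
  induction i generalizing Z with
  | zero => exact hZ
  | succ i ih =>
    exact ⟨Z, 𝟙 Z, D.zero _ hZ, inferInstance, ih (isZero_kernel_of_mono _)⟩

lemma zero_cores (D : Data 𝒲 j) (i : ℕ) {Z : A} (hZ : IsZero Z) : Z ∈ coresSet A 𝒲 i := by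
  induction i generalizing Z with
  | zero => exact hZ
  | succ i ih =>
    exact ⟨Z, 𝟙 Z, D.zero _ hZ, inferInstance, ih (isZero_cokernel_of_epi _)⟩

open ZeroObject in
lemma eq (D : Data 𝒲 j) : resSet A 𝒲 (j + 1) = coresSet A 𝒲 (j + 1) := by
  apply Set.Subset.antisymm
  · intro X hX
    exact coresSet_iso _ cokernelZeroIsoTarget
      (D.coker_mem (D.zero_res _ (isZero_zero A)) hX (0 : (0 : A) ⟶ X))
  · intro X hX
    exact resSet_iso _ kernelZeroIsoSource
      (D.ker_mem hX (D.zero_cores _ (isZero_zero A)) (0 : X ⟶ (0 : A)))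

lemma mem (D : Data 𝒲 j) {W : A} (hW : W ∈ 𝒲) : W ∈ resSet A 𝒲 (j + 1) :=
  ⟨W, 𝟙 W, hW, inferInstance, D.zero_res _ (isZero_kernel_of_mono _)⟩

lemma three (D : Data 𝒲 j) {S : ShortComplex A} (hS : S.ShortExact) (h₁ : S.X₁ ∈ resSet A 𝒲 (j + 1))
    (h₂ : S.X₂ ∈ resSet A 𝒲 (j + 1)) : S.X₃ ∈ resSet A 𝒲 (j + 1) :=
  resSet_iso _ ((cokernelIsCokernel _).coconePointUniqueUpToIso hS.gIsCokernel)
    (by rw [D.eq]; exact D.coker_mem h₁ h₂ S.f)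

lemma one (D : Data 𝒲 j) {S : ShortComplex A} (hS : S.ShortExact) (h₂ : S.X₂ ∈ resSet A 𝒲 (j + 1))
    (h₃ : S.X₃ ∈ resSet A 𝒲 (j + 1)) : S.X₁ ∈ resSet A 𝒲 (j + 1) := by
  rw [D.eq] at h₂ h₃
  exact resSet_iso _ ((kernelIsKernel _).conePointUniqueUpToIso hS.fIsKernel) (D.ker_mem h₂ h₃ S.g)

lemma two (D : Data 𝒲 j) {S : ShortComplex A} (hS : S.ShortExact) (h₁ : S.X₁ ∈ resSet A 𝒲 (j + 1))
    (h₃ : S.X₃ ∈ resSet A 𝒲 (j + 1)) : S.X₂ ∈ resSet A 𝒲 (j + 1) := by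
  obtain ⟨V, hV, p, hp⟩ := D.cover h₃
  have sq := IsPullback.of_hasPullback S.g p
  obtain ⟨i, hi, -, hT⟩ := pullback_shortExact hS sq
  obtain ⟨i', hi', -, hT'⟩ := pullback_shortExact (kerShort p) sq.flip
  have hk : kernel p ∈ resSet A 𝒲 (j + 1) := D.one (kerShort p) (D.mem hV) h₃
  refine D.three hT' hk ?_
  obtain ⟨U, hU, m, hm⟩ := D.hull (D.eq ▸ h₁)
  have sq' := IsPushout.of_hasPushout i m
  obtain ⟨q, hq, -, hR⟩ := pushout_shortExact hT sq'
  obtain ⟨q', hq', -, hR'⟩ := pushout_shortExact (cokerShort m) sq'.flip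
  have hE : pushout i m ∈ 𝒲 := D.ext _ hR hU hV
  have hc : cokernel m ∈ resSet A 𝒲 (j + 1) := D.three (cokerShort m) h₁ (D.mem hU)
  exact D.one hR' (D.mem hE) hc

end Data

lemma seqOne_shortExact {X Y : A} (s : ExtSeq A 1 X Y) :
    (ShortComplex.mk (s.d 1) (s.d 0) (s.w 0)).ShortExact :=
  { exact := s.ex 0
    epi_g := s.epi0
    mono_f := (s.ex 1).mono_g ((s.is_zero 3 (by lia)).eq_of_src _ _) }

lemma mid_iso {X Y : A} {s t : ExtSeq A 1 X Y} (h : YonedaEquiv s t) :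
    Nonempty (s.ob 1 ≅ t.ob 1) := by
  induction h with
  | rel x y h =>
    obtain ⟨f⟩ := h
    let ψ : ShortComplex.mk (x.d 1) (x.d 0) (x.w 0) ⟶ ShortComplex.mk (y.d 1) (y.d 0) (y.w 0) :=
      { τ₁ := f.φ 2, τ₂ := f.φ 1, τ₃ := f.φ 0
        comm₁₂ := (f.comm 1).symm
        comm₂₃ := (f.comm 0).symm }
    have h1 : IsIso ψ.τ₁ := by
      have : IsIso (f.φ (1 + 1)) := by rw [f.φTop]; infer_instance
      exact this
    have h3 : IsIso ψ.τ₃ := by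
      have : IsIso (f.φ 0) := by rw [f.φ0]; infer_instance
      exact this
    have h2 : IsIso ψ.τ₂ := ShortComplex.isIso₂_of_shortExact_of_isIso₁₃ ψ
      (seqOne_shortExact x) (seqOne_shortExact y)
    exact ⟨@asIso _ _ _ _ ψ.τ₂ h2⟩
  | refl x => exact ⟨Iso.refl _⟩
  | symm x y _ ih => exact ⟨ih.some.symm⟩
  | trans x y z _ _ h1 h2 => exact ⟨h1.some ≪≫ h2.some⟩

lemma ext_one {𝒲 : Set A} (hWiso : ∀ X Y : A, (X ≅ Y) → X ∈ 𝒲 → Y ∈ 𝒲)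
    (hWdext : DExtClosed A 𝒲 1) (S : ShortComplex A) (hS : S.ShortExact)
    (h₁ : S.X₁ ∈ 𝒲) (h₃ : S.X₃ ∈ 𝒲) : S.X₂ ∈ 𝒲 := by
  letI := HasExt.standard A
  obtain ⟨t, ht, h⟩ := hWdext _ _ h₃ h₁ (cons hS (triv S.X₁))
  obtain ⟨e⟩ := mid_iso h
  exact hWiso _ _ e.symm (ht 1 le_rfl le_rfl)

lemma ext_split [HasExt.{w} A] {𝒲 : Set A} (hWiso : ∀ X Y : A, (X ≅ Y) → X ∈ 𝒲 → Y ∈ 𝒲)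
    (hWadd : ∀ X Y : A, X ∈ 𝒲 → Y ∈ 𝒲 → (X ⊞ Y) ∈ 𝒲)
    (S : ShortComplex A) (hS : S.ShortExact) (h : Subsingleton (Ext S.X₃ S.X₁ 1))
    (h₁ : S.X₁ ∈ 𝒲) (h₃ : S.X₃ ∈ 𝒲) : S.X₂ ∈ 𝒲 := by
  obtain ⟨l, hl⟩ := lift_of_ext hS h (𝟙 _)
  have := hS.mono_f
  let σ := ShortComplex.Splitting.ofExactOfSection S hS.exact l hl hS.mono_f
  exact hWiso _ _ σ.isoBinaryBiproduct.symm (hWadd _ _ h₁ h₃)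

end DWide

/-- if `𝒲` is a `d`-wide subcategory of a `d`-cluster tilting subcategory `ℳ`
of an abelian category `A`, then `𝒲_d(A) = 𝒲^d(A)`, and this common subcategory is wide:
closed under extensions, kernels and cokernels. -/
theorem d_wide_gives_wide_subcategory
    (A : Type u) [Category.{v} A] [Abelian A] (d : ℕ) (hd : 1 ≤ d)
    (ℳ : Set A)
    -- `ℳ` is a `d`-cluster tilting subcategory of `A`:
    (hMiso : ∀ X Y : A, (X ≅ Y) → X ∈ ℳ → Y ∈ ℳ)
    (hcontra : ∀ X : A, ∃ M ∈ ℳ, ∃ f : M ⟶ X, ∀ M' ∈ ℳ, ∀ g : M' ⟶ X, ∃ h : M' ⟶ M, h ≫ f = g)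
    (hcov : ∀ X : A, ∃ M ∈ ℳ, ∃ f : X ⟶ M, ∀ M' ∈ ℳ, ∀ g : X ⟶ M', ∃ h : M ⟶ M', f ≫ h = g)
    (hgen : ∀ X : A, ∃ M ∈ ℳ, ∃ f : M ⟶ X, Epi f)
    (hcogen : ∀ X : A, ∃ M ∈ ℳ, ∃ f : X ⟶ M, Mono f)
    (heq1 : ℳ = {X : A | ∀ i, 0 < i → i < d → ∀ M ∈ ℳ, extVanish A i X M})
    (heq2 : ℳ = {X : A | ∀ i, 0 < i → i < d → ∀ M ∈ ℳ, extVanish A i M X})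
    -- `𝒲` is a `d`-wide subcategory of `ℳ`:
    (𝒲 : Set A) (hWM : 𝒲 ⊆ ℳ)
    (hW0 : ∀ Z : A, IsZero Z → Z ∈ 𝒲)
    (hWadd : ∀ X Y : A, X ∈ 𝒲 → Y ∈ 𝒲 → (X ⊞ Y) ∈ 𝒲)
    (hWiso : ∀ X Y : A, (X ≅ Y) → X ∈ 𝒲 → Y ∈ 𝒲)
    (hWsummand : ∀ (X Y : A) (r : X ⟶ Y) (ι : Y ⟶ X), ι ≫ r = 𝟙 Y → X ∈ 𝒲 → Y ∈ 𝒲)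
    (hWdext : DExtClosed A 𝒲 d)
    (hWker : ∀ X ∈ 𝒲, ∀ Y ∈ 𝒲, ∀ f : X ⟶ Y, kernel f ∈ resSet A 𝒲 d)
    (hWcoker : ∀ X ∈ 𝒲, ∀ Y ∈ 𝒲, ∀ f : X ⟶ Y, cokernel f ∈ coresSet A 𝒲 d) :
    resSet A 𝒲 d = coresSet A 𝒲 d ∧
    (∀ S : ShortComplex A, S.ShortExact → S.X₁ ∈ resSet A 𝒲 d → S.X₃ ∈ resSet A 𝒲 d →
      S.X₂ ∈ resSet A 𝒲 d) ∧
    (∀ X Y : A, X ∈ resSet A 𝒲 d → Y ∈ resSet A 𝒲 d → ∀ f : X ⟶ Y,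
      kernel f ∈ resSet A 𝒲 d ∧ cokernel f ∈ resSet A 𝒲 d) := by
  classical
  obtain ⟨j, rfl⟩ : ∃ j, d = j + 1 := ⟨d - 1, by lia⟩
  letI : HasExt.{max u v} A := HasExt.standard A
  have hv : ∀ M ∈ ℳ, ∀ N ∈ ℳ, ∀ i, 0 < i → i < j + 1 →
      Subsingleton (Abelian.Ext.{max u v} M N i) := by
    intro M hM N hN i hi hi'
    rw [heq1] at hM
    exact DWide.subsingleton_ext hi (hM i hi hi' N hN)
  have D : DWide.Data 𝒲 j :=
    { zero := hW0
      add := hWadd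
      ker := hWker
      coker := hWcoker
      lift := by
        intro M hM V X f hf hk g
        exact DWide.lift_of_ext (DWide.kerShort f) (DWide.vanish_res
          (fun W hW => hv M (hWM hM) W (hWM hW)) j _ hk 1 (by lia) (by lia)) g
      extend := by
        intro M hM V X f hf hk g
        exact DWide.extend_of_ext (DWide.cokerShort f) (DWide.vanish_cores
          (fun W hW => hv W (hWM hW) M (hWM hM)) j _ hk 1 (by lia) (by lia)) g
      ext := by
        intro S hS h₁ h₃
        by_cases hj : j = 0
        · subst hj
          exact DWide.ext_one hWiso hWdext S hS h₁ h₃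
        · exact DWide.ext_split hWiso hWadd S hS
            (hv _ (hWM h₃) _ (hWM h₁) 1 (by lia) (by lia)) h₁ h₃ }
  refine ⟨D.eq, fun S hS h₁ h₃ => D.two hS h₁ h₃, fun X Y hX hY f => ⟨?_, ?_⟩⟩
  · rw [D.eq] at hX hY
    exact D.ker_mem hX hY f
  · rw [D.eq]
    rw [D.eq] at hX hY
    rw [← D.eq] at hX hY
    exact D.coker_mem hX hY f
end

section
/- Let E be a weakly idempotent complete exact category with d-cluster tilting subcategory M, and let m, n be positive integers with m + n = d. An object X ∈ E satisfies Ext^i_E(X,M) = 0 for all 0 < i < m and Ext^j_E(M,X) = 0 for all 0 < j < n if and only if there exists an exact sequence 0 → M_{d+1} → M_d → ⋯ → M_0 → 0 in E with all M_i ∈ M such that X is isomorphic to the image of M_{n+1} → M_n. -/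
open CategoryTheory CategoryTheory.Limits

universe v u v' u'

/-- The data of a class of conflations (kernel–cokernel pairs) on an additive category,
encoded as a class of short complexes. -/
class ExactCatStruct (E : Type u) [Category.{v} E] [Preadditive E] : Type (max u v) where
  conflation : Set (ShortComplex E)

variable {E : Type u} [Category.{v} E] [Preadditive E]

/-- A morphism is an inflation if it occurs as the first map of a conflation. -/
def Inflation [ExactCatStruct E] {X Y : E} (f : X ⟶ Y) : Prop :=
  ∃ (Z : E) (g : Y ⟶ Z) (w : f ≫ g = 0), ShortComplex.mk f g w ∈ ExactCatStruct.conflation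

/-- A morphism is a deflation if it occurs as the second map of a conflation. -/
def Deflation [ExactCatStruct E] {Y Z : E} (g : Y ⟶ Z) : Prop :=
  ∃ (X : E) (f : X ⟶ Y) (w : f ≫ g = 0), ShortComplex.mk f g w ∈ ExactCatStruct.conflation

/-- The axioms of a Quillen exact category, for a given class of conflations. -/
class IsExactCat (E : Type u) [Category.{v} E] [Preadditive E] [ExactCatStruct E] : Prop where
  iso_closed : ∀ {S T : ShortComplex E}, (S ≅ T) →
    S ∈ ExactCatStruct.conflation (E := E) → T ∈ ExactCatStruct.conflation
  conf_kernel : ∀ S ∈ ExactCatStruct.conflation (E := E),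
    Nonempty (IsLimit (KernelFork.ofι S.f S.zero))
  conf_cokernel : ∀ S ∈ ExactCatStruct.conflation (E := E),
    Nonempty (IsColimit (CokernelCofork.ofπ S.g S.zero))
  id_inflation : ∀ X : E, Inflation (𝟙 X)
  id_deflation : ∀ X : E, Deflation (𝟙 X)
  comp_inflation : ∀ {X Y Z : E} (f : X ⟶ Y) (g : Y ⟶ Z),
    Inflation f → Inflation g → Inflation (f ≫ g)
  comp_deflation : ∀ {X Y Z : E} (f : X ⟶ Y) (g : Y ⟶ Z),
    Deflation f → Deflation g → Deflation (f ≫ g)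
  pullback_deflation : ∀ {X Y Z : E} (p : Y ⟶ Z) (f : X ⟶ Z), Deflation p →
    ∃ (W : E) (f' : W ⟶ Y) (p' : W ⟶ X), Deflation p' ∧ IsPullback f' p' p f
  pushout_inflation : ∀ {X Y Z : E} (i : X ⟶ Y) (f : X ⟶ Z), Inflation i →
    ∃ (W : E) (i' : Z ⟶ W) (g : Y ⟶ W), Inflation i' ∧ IsPushout i f g i'

/-- Weak idempotent completeness: every split epimorphism has a kernel. -/
def WeaklyIdemComplete (E : Type u) [Category.{v} E] [Preadditive E] : Prop :=
  ∀ ⦃X Y : E⦄ (f : X ⟶ Y), IsSplitEpi f → HasKernel f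

variable (E) in
/-- An exact (acyclic) sequence `0 → Y → E_n → ⋯ → E_1 → X → 0` in an exact category,
with the factorization of its differentials through conflations as part of the data:
`Z i` is the splice object between `ob (i+1)` and `ob i`. -/
structure EExtSeq [ExactCatStruct E] (n : ℕ) (X Y : E) where
  ob : ℕ → E
  Z : ℕ → E
  π : ∀ i, ob (i + 1) ⟶ Z i
  ι : ∀ i, Z i ⟶ ob i
  iso0 : ob 0 ≅ X
  isoTop : ob (n + 1) ≅ Y
  ob_zero : ∀ i, n + 1 < i → IsZero (ob i)
  Z_zero : ∀ i, n < i → IsZero (Z i)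
  w : ∀ i, ι (i + 1) ≫ π i = 0
  confl : ∀ i, ShortComplex.mk (ι (i + 1)) (π i) (w i) ∈ ExactCatStruct.conflation
  iso_bot : IsIso (ι 0)

/-- The differentials of an acyclic sequence. -/
def EExtSeq.dd [ExactCatStruct E] {n : ℕ} {X Y : E} (s : EExtSeq E n X Y) (i : ℕ) :
    s.ob (i + 1) ⟶ s.ob i :=
  s.π i ≫ s.ι i

lemma EExtSeq.dd_comp [ExactCatStruct E] {n : ℕ} {X Y : E} (s : EExtSeq E n X Y) (i : ℕ) :
    s.dd (i + 1) ≫ s.dd i = 0 := by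
  show (s.π (i + 1) ≫ s.ι (i + 1)) ≫ s.π i ≫ s.ι i = 0
  rw [Category.assoc, ← Category.assoc (s.ι (i + 1)) (s.π i) (s.ι i), s.w i, zero_comp,
    comp_zero]

/-- A morphism of acyclic sequences inducing the identity on the end terms. -/
structure EExtSeqHom [ExactCatStruct E] {n : ℕ} {X Y : E} (s t : EExtSeq E n X Y) where
  φ : ∀ i, s.ob i ⟶ t.ob i
  comm : ∀ i, s.dd i ≫ φ i = φ (i + 1) ≫ t.dd i
  φ0 : φ 0 = s.iso0.hom ≫ t.iso0.inv
  φTop : φ (n + 1) = s.isoTop.hom ≫ t.isoTop.inv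

/-- Yoneda equivalence of `n`-fold extensions in an exact category. -/
def EYonedaEquiv [ExactCatStruct E] {n : ℕ} {X Y : E} :
    EExtSeq E n X Y → EExtSeq E n X Y → Prop :=
  Relation.EqvGen fun s t => Nonempty (EExtSeqHom s t)

variable (E) in
/-- Vanishing of the Yoneda Ext-group `Ext^n_E(X, Y)` of an exact category:
all `n`-fold extensions of `X` by `Y` are Yoneda equivalent. -/
def eExtVanish [ExactCatStruct E] (n : ℕ) (X Y : E) : Prop :=
  ∀ s t : EExtSeq E n X Y, EYonedaEquiv s t

variable (E) in
/-- `ℳ` is a `d`-cluster tilting subcategory of the exact category `E`. -/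
structure IsDCT [ExactCatStruct E] (ℳ : Set E) (d : ℕ) : Prop where
  iso_closed : ∀ X Y : E, (X ≅ Y) → X ∈ ℳ → Y ∈ ℳ
  generating : ∀ X : E, ∃ M ∈ ℳ, ∃ f : M ⟶ X, Deflation f
  cogenerating : ∀ X : E, ∃ M ∈ ℳ, ∃ f : X ⟶ M, Inflation f
  contravariantly_finite : ∀ X : E, ∃ M ∈ ℳ, ∃ f : M ⟶ X,
    ∀ M' ∈ ℳ, ∀ g : M' ⟶ X, ∃ h : M' ⟶ M, h ≫ f = g
  covariantly_finite : ∀ X : E, ∃ M ∈ ℳ, ∃ f : X ⟶ M,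
    ∀ M' ∈ ℳ, ∀ g : X ⟶ M', ∃ h : M ⟶ M', f ≫ h = g
  eq_left_perp : ℳ = {X : E | ∀ i, 0 < i → i < d → ∀ M ∈ ℳ, eExtVanish E i X M}
  eq_right_perp : ℳ = {X : E | ∀ i, 0 < i → i < d → ∀ M ∈ ℳ, eExtVanish E i M X}

variable (E) in
/-- The subcategory `E_{m,n}` of objects `X` with `Ext^i(X, ℳ) = 0` for `0 < i < m`
and `Ext^j(ℳ, X) = 0` for `0 < j < n`. -/
def Emn [ExactCatStruct E] (ℳ : Set E) (m n : ℕ) : Set E :=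
  {X : E | (∀ i, 0 < i → i < m → ∀ M ∈ ℳ, eExtVanish E i X M) ∧
    (∀ j, 0 < j → j < n → ∀ M ∈ ℳ, eExtVanish E j M X)}


namespace DCT

open Opposite

/-- A conflation with prescribed ends. -/
structure Conf [ExactCatStruct E] (K A : E) where
  P : E
  i : K ⟶ P
  p : P ⟶ A
  w : i ≫ p = 0
  mem : ShortComplex.mk i p w ∈ ExactCatStruct.conflation

instance opStruct [ExactCatStruct E] : ExactCatStruct Eᵒᵖ where
  conflation := {S | S.unop ∈ ExactCatStruct.conflation (E := E)}

section
variable [ExactCatStruct E]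

def Conf.op {K A : E} (c : Conf K A) : Conf (op A) (op K) where
  P := Opposite.op c.P
  i := c.p.op
  p := c.i.op
  w := by rw [← op_comp, c.w, op_zero]
  mem := c.mem

def Conf.unop {K A : Eᵒᵖ} (c : Conf K A) : Conf (unop A) (unop K) where
  P := Opposite.unop c.P
  i := c.p.unop
  p := c.i.unop
  w := by rw [← unop_comp, c.w, unop_zero]
  mem := c.mem

lemma Conf.deflation {K A : E} (c : Conf K A) : Deflation c.p := ⟨_, _, c.w, c.mem⟩
lemma Conf.inflation {K A : E} (c : Conf K A) : Inflation c.i := ⟨_, _, c.w, c.mem⟩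

lemma inflation_op {X Y : E} {f : X ⟶ Y} (h : Inflation f) : Deflation f.op := by
  obtain ⟨Z, g, w, hm⟩ := h
  exact (Conf.op ⟨_, f, g, w, hm⟩).deflation
lemma deflation_op {X Y : E} {f : X ⟶ Y} (h : Deflation f) : Inflation f.op := by
  obtain ⟨Z, g, w, hm⟩ := h
  exact (Conf.op ⟨_, g, f, w, hm⟩).inflation
lemma inflation_unop {X Y : Eᵒᵖ} {f : X ⟶ Y} (h : Inflation f) : Deflation f.unop := by
  obtain ⟨Z, g, w, hm⟩ := h
  exact (Conf.unop ⟨_, f, g, w, hm⟩).deflation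
lemma deflation_unop {X Y : Eᵒᵖ} {f : X ⟶ Y} (h : Deflation f) : Inflation f.unop := by
  obtain ⟨Z, g, w, hm⟩ := h
  exact (Conf.unop ⟨_, g, f, w, hm⟩).inflation

instance opExact [IsExactCat E] : IsExactCat Eᵒᵖ where
  iso_closed {S T} e h := IsExactCat.iso_closed (E := E)
    (ShortComplex.isoMk (ShortComplex.π₃.mapIso e).unop.symm (ShortComplex.π₂.mapIso e).unop.symm
      (ShortComplex.π₁.mapIso e).unop.symm
      (Quiver.Hom.op_inj (by exact (e.inv.comm₂₃).symm))
      (Quiver.Hom.op_inj (by exact (e.inv.comm₁₂).symm))) h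
  conf_kernel S h := by
    obtain ⟨H⟩ := IsExactCat.conf_cokernel (E := E) S.unop h
    exact ⟨CokernelCofork.IsColimit.ofπOp _ _ H⟩
  conf_cokernel S h := by
    obtain ⟨H⟩ := IsExactCat.conf_kernel (E := E) S.unop h
    exact ⟨KernelFork.IsLimit.ofιOp _ _ H⟩
  id_inflation X := deflation_op (IsExactCat.id_deflation (unop X))
  id_deflation X := inflation_op (IsExactCat.id_inflation (unop X))
  comp_inflation f g hf hg :=
    deflation_op (IsExactCat.comp_deflation g.unop f.unop (inflation_unop hg) (inflation_unop hf))
  comp_deflation f g hf hg :=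
    inflation_op (IsExactCat.comp_inflation g.unop f.unop (deflation_unop hg) (deflation_unop hf))
  pullback_deflation p f hp := by
    obtain ⟨W, i', g, hi, H⟩ := IsExactCat.pushout_inflation p.unop f.unop (deflation_unop hp)
    exact ⟨op W, g.op, i'.op, inflation_op hi, H.op.flip⟩
  pushout_inflation i f hi := by
    obtain ⟨W, f', p', hp, H⟩ := IsExactCat.pullback_deflation i.unop f.unop (inflation_unop hi)
    exact ⟨op W, p'.op, f'.op, deflation_op hp, H.op.flip⟩

variable [IsExactCat E]

instance Conf.mono_i {K A : E} (c : Conf K A) : Mono c.i := by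
  obtain ⟨h⟩ := IsExactCat.conf_kernel _ c.mem
  exact mono_of_isLimit_fork h
instance Conf.epi_p {K A : E} (c : Conf K A) : Epi c.p := by
  obtain ⟨h⟩ := IsExactCat.conf_cokernel _ c.mem
  exact epi_of_isColimit_cofork h

lemma Conf.lift {K A T : E} (c : Conf K A) (f : T ⟶ c.P) (hf : f ≫ c.p = 0) :
    ∃ g : T ⟶ K, g ≫ c.i = f := by
  obtain ⟨h⟩ := IsExactCat.conf_kernel _ c.mem
  exact ⟨_, (KernelFork.IsLimit.lift' h f hf).2⟩
lemma Conf.desc {K A T : E} (c : Conf K A) (f : c.P ⟶ T) (hf : c.i ≫ f = 0) :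
    ∃ g : A ⟶ T, c.p ≫ g = f := by
  obtain ⟨h⟩ := IsExactCat.conf_cokernel _ c.mem
  exact ⟨_, (CokernelCofork.IsColimit.desc' h f hf).2⟩

attribute [simp] Conf.w

@[simp] lemma Conf.w_assoc {K A Z : E} (c : Conf K A) (h : A ⟶ Z) : c.i ≫ c.p ≫ h = 0 := by
  rw [← Category.assoc, c.w, zero_comp]

/-- Transport a conflation along isomorphisms. -/
def Conf.iso {K A K' A' P' : E} (c : Conf K A) (e : K' ≅ K) (eP : P' ≅ c.P) (eA : A' ≅ A)
    (i' : K' ⟶ P') (p' : P' ⟶ A') (hi : i' ≫ eP.hom = e.hom ≫ c.i)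
    (hp : p' ≫ eA.hom = eP.hom ≫ c.p) : Conf K' A' where
  P := P'
  i := i'
  p := p'
  w := by rw [← cancel_mono eA.hom, Category.assoc, hp, reassoc_of% hi]; simp
  mem := IsExactCat.iso_closed
    (ShortComplex.isoMk (S₁ := ShortComplex.mk c.i c.p c.w) (S₂ := ShortComplex.mk i' p' _)
      e.symm eP.symm eA.symm
      (by simp [← cancel_mono eP.hom, hi]) (by simp [← cancel_mono eA.hom, hp])) c.mem

/-- Every conflation pulls back. -/
lemma Conf.pullback {K A A' : E} (c : Conf K A) (a : A' ⟶ A) :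
    ∃ (c' : Conf K A') (φ : c'.P ⟶ c.P), IsPullback φ c'.p c.p a ∧ c'.i ≫ φ = c.i := by
  obtain ⟨W, f, p', ⟨K', i', w', hm⟩, H⟩ := IsExactCat.pullback_deflation c.p a c.deflation
  let c1 : Conf K' A' := ⟨W, i', p', w', hm⟩
  have w1 : c.i ≫ c.p = 0 ≫ a := by simp
  obtain ⟨g, hg⟩ := c1.lift (H.lift c.i 0 w1) (H.lift_snd _ _ w1)
  obtain ⟨g', hg'⟩ := c.lift (i' ≫ f) (by rw [Category.assoc, H.w, reassoc_of% w', zero_comp])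
  change g ≫ i' = _ at hg
  have h1 : g ≫ g' = 𝟙 K := by
    rw [← cancel_mono c.i, Category.assoc, hg', reassoc_of% hg, H.lift_fst, Category.id_comp]
  have h2 : g' ≫ g = 𝟙 K' := by
    have : Mono i' := c1.mono_i
    rw [← cancel_mono i', Category.assoc, hg]
    apply H.hom_ext
    · simp [hg']
    · simp [w']
  exact ⟨c1.iso ⟨g, g', h1, h2⟩ (Iso.refl _) (Iso.refl _) (H.lift c.i 0 w1) p'
    (by simp [c1, hg]) (by simp [c1]), f, H, H.lift_fst _ _ _⟩

/-- Every conflation pushes out. -/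
lemma Conf.pushout {K A K' : E} (c : Conf K A) (k : K ⟶ K') :
    ∃ (c' : Conf K' A) (φ : c.P ⟶ c'.P), IsPushout c.i k φ c'.i ∧ φ ≫ c'.p = c.p := by
  obtain ⟨c', φ, H, h⟩ := c.op.pullback k.op
  exact ⟨c'.unop, φ.unop, H.unop.flip, Quiver.Hom.op_inj h⟩

/-- A conflation with zero kernel. -/
lemma exists_triv (A : E) : ∃ (K : E) (c : Conf K A), IsZero K ∧ c.P = A ∧ IsIso c.p := by
  obtain ⟨K, i, w, hm⟩ := IsExactCat.id_deflation A
  let c : Conf K A := ⟨A, i, 𝟙 A, w, hm⟩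
  refine ⟨K, c, ?_, rfl, inferInstanceAs (IsIso (𝟙 A))⟩
  have : Mono i := c.mono_i
  rw [IsZero.iff_id_eq_zero, ← cancel_mono i]
  simpa using w

def confZero {Z : E} (hZ : IsZero Z) (A : E) : Conf Z A where
  P := A
  i := 0
  p := 𝟙 A
  w := by simp
  mem := by
    obtain ⟨K, i, w, hm⟩ := IsExactCat.id_deflation A
    let c : Conf K A := ⟨A, i, 𝟙 A, w, hm⟩
    have hK : IsZero K := by
      have : Mono i := c.mono_i
      rw [IsZero.iff_id_eq_zero, ← cancel_mono i]
      simpa using w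
    exact (c.iso (hZ.iso hK) (Iso.refl _) (Iso.refl _) 0 (𝟙 A) (hZ.eq_of_src _ _) (by simp [c])).mem

lemma exists_isZero (A : E) : ∃ Z : E, IsZero Z := by
  obtain ⟨K, _, h, _⟩ := exists_triv A
  exact ⟨K, h⟩

/-- Split conflations. -/
lemma exists_split (Y A : E) : ∃ (c : Conf Y A) (σ : A ⟶ c.P) (h : c.P ⟶ Y),
    σ ≫ c.p = 𝟙 A ∧ c.i ≫ h = 𝟙 Y ∧ σ ≫ h = 0 ∧ c.p ≫ σ + h ≫ c.i = 𝟙 c.P := by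
  obtain ⟨Z, hZ⟩ := exists_isZero A
  obtain ⟨c, σ, H, hp⟩ := (confZero hZ A).pushout (0 : Z ⟶ Y)
  have w : (confZero hZ A).i ≫ (0 : A ⟶ Y) = (0 : Z ⟶ Y) ≫ 𝟙 Y := hZ.eq_of_src _ _
  change A ⟶ c.P at σ
  change σ ≫ c.p = 𝟙 A at hp
  refine ⟨c, σ, H.desc 0 (𝟙 Y) w, hp, H.inr_desc _ _ _, H.inl_desc _ _ _, ?_⟩
  have e1 : σ ≫ H.desc 0 (𝟙 Y) w = 0 := H.inl_desc _ _ _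
  have e2 : c.i ≫ H.desc 0 (𝟙 Y) w = 𝟙 Y := H.inr_desc _ _ _
  apply H.hom_ext
  · change σ ≫ _ = σ ≫ _
    simp [reassoc_of% e1, reassoc_of% hp]
  · simp [reassoc_of% e2]

end
end DCT

namespace DCT

open Opposite

section
variable [ExactCatStruct E]

/-- Morphisms of conflations with prescribed end components. -/
def ConfHom {K A K' A' : E} (c : Conf K A) (c' : Conf K' A') (a : A ⟶ A') (k : K ⟶ K') : Prop :=
  ∃ φ : c.P ⟶ c'.P, c.i ≫ φ = k ≫ c'.i ∧ φ ≫ c'.p = c.p ≫ a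

/-- Iterated conflations: `Res n A K` is the type of exact sequences
`0 → K → P_{n+1} → ⋯ → P_1 → A → 0`. -/
def Res : ℕ → E → E → Type (max u v)
  | 0, A, K => Conf K A
  | n + 1, A, K => Σ K1 : E, Conf K1 A × Res n K1 K

def Res.Hom : ∀ (n : ℕ) {A K A' K' : E}, Res n A K → Res n A' K' → (A ⟶ A') → (K ⟶ K') → Prop
  | 0, _, _, _, _, c, c', a, k => ConfHom c c' a k
  | n + 1, _, _, _, _, r, r', a, k =>
      ∃ k1 : r.1 ⟶ r'.1, ConfHom r.2.1 r'.2.1 a k1 ∧ Res.Hom n r.2.2 r'.2.2 k1 k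

/-- `f` extends along the last inflation. -/
def Res.Fac : ∀ (n : ℕ) {A K Y : E}, Res n A K → (K ⟶ Y) → Prop
  | 0, _, _, Y, c, f => ∃ h : Conf.P c ⟶ Y, Conf.i c ≫ h = f
  | n + 1, _, _, _, r, f => Res.Fac n r.2.2 f

def Res.snoc : ∀ (n : ℕ) {A K L : E}, Res n A K → Conf L K → Res (n + 1) A L
  | 0, _, K, _, c0, c => ⟨K, c0, c⟩
  | n + 1, _, _, _, r, c => ⟨r.1, r.2.1, Res.snoc n r.2.2 c⟩

lemma ConfHom.id {K A : E} (c : Conf K A) : ConfHom c c (𝟙 A) (𝟙 K) := ⟨𝟙 _, by simp, by simp⟩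

lemma ConfHom.zero {K A K' A' : E} (c : Conf K A) (c' : Conf K' A') : ConfHom c c' 0 0 :=
  ⟨0, by simp, by simp⟩

lemma ConfHom.comp {K A K' A' K'' A'' : E} {c : Conf K A} {c' : Conf K' A'} {c'' : Conf K'' A''}
    {a a' k k'} (h : ConfHom c c' a k) (h' : ConfHom c' c'' a' k') :
    ConfHom c c'' (a ≫ a') (k ≫ k') := by
  obtain ⟨φ, h1, h2⟩ := h
  obtain ⟨ψ, h3, h4⟩ := h'
  exact ⟨φ ≫ ψ, by rw [reassoc_of% h1, h3, Category.assoc], by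
    rw [Category.assoc, h4, reassoc_of% h2]⟩

lemma ConfHom.add {K A K' A' : E} {c : Conf K A} {c' : Conf K' A'}
    {a a' k k'} (h : ConfHom c c' a k) (h' : ConfHom c c' a' k') :
    ConfHom c c' (a + a') (k + k') := by
  obtain ⟨φ, h1, h2⟩ := h
  obtain ⟨ψ, h3, h4⟩ := h'
  exact ⟨φ + ψ, by simp [h1, h3], by simp [h2, h4]⟩

lemma ConfHom.sub {K A K' A' : E} {c : Conf K A} {c' : Conf K' A'}
    {a a' k k'} (h : ConfHom c c' a k) (h' : ConfHom c c' a' k') :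
    ConfHom c c' (a - a') (k - k') := by
  obtain ⟨φ, h1, h2⟩ := h
  obtain ⟨ψ, h3, h4⟩ := h'
  exact ⟨φ - ψ, by simp [h1, h3], by simp [h2, h4]⟩

namespace Res

lemma Hom.id : ∀ (n : ℕ) {A K : E} (r : Res n A K), Hom n r r (𝟙 A) (𝟙 K)
  | 0, _, _, c => ConfHom.id c
  | n + 1, _, _, r => ⟨𝟙 _, ConfHom.id _, Hom.id n _⟩

lemma Hom.zero : ∀ (n : ℕ) {A K A' K' : E} (r : Res n A K) (r' : Res n A' K'), Hom n r r' 0 0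
  | 0, _, _, _, _, c, c' => ConfHom.zero c c'
  | n + 1, _, _, _, _, r, r' => ⟨0, ConfHom.zero _ _, Hom.zero n _ _⟩

lemma Hom.comp : ∀ {n : ℕ} {A K A' K' A'' K'' : E} {r : Res n A K} {r' : Res n A' K'}
    {r'' : Res n A'' K''} {a k a' k'}, Hom n r r' a k → Hom n r' r'' a' k' →
    Hom n r r'' (a ≫ a') (k ≫ k')
  | 0, _, _, _, _, _, _, _, _, _, _, _, _, _, h, h' => ConfHom.comp h h'
  | _ + 1, _, _, _, _, _, _, _, _, _, _, _, _, _, ⟨_, h1, h2⟩, ⟨_, h1', h2'⟩ =>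
    ⟨_, h1.comp h1', h2.comp h2'⟩

lemma Hom.add : ∀ {n : ℕ} {A K A' K' : E} {r : Res n A K} {r' : Res n A' K'}
    {a k a' k'}, Hom n r r' a k → Hom n r r' a' k' → Hom n r r' (a + a') (k + k')
  | 0, _, _, _, _, _, _, _, _, _, _, h, h' => ConfHom.add h h'
  | _ + 1, _, _, _, _, _, _, _, _, _, _, ⟨_, h1, h2⟩, ⟨_, h1', h2'⟩ =>
    ⟨_, h1.add h1', h2.add h2'⟩

lemma Hom.sub : ∀ {n : ℕ} {A K A' K' : E} {r : Res n A K} {r' : Res n A' K'}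
    {a k a' k'}, Hom n r r' a k → Hom n r r' a' k' → Hom n r r' (a - a') (k - k')
  | 0, _, _, _, _, _, _, _, _, _, _, h, h' => ConfHom.sub h h'
  | _ + 1, _, _, _, _, _, _, _, _, _, _, ⟨_, h1, h2⟩, ⟨_, h1', h2'⟩ =>
    ⟨_, h1.sub h1', h2.sub h2'⟩

lemma Fac.comp : ∀ {n : ℕ} {A K Y Y' : E} {r : Res n A K} {f : K ⟶ Y}, Fac n r f →
    ∀ g : Y ⟶ Y', Fac n r (f ≫ g)
  | 0, _, _, _, _, _, _, ⟨h, hh⟩, g => ⟨h ≫ g, by rw [← hh, Category.assoc]⟩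
  | n + 1, _, _, _, _, r, f, h, g => Fac.comp (n := n) (r := r.2.2) h g

lemma Fac.add : ∀ {n : ℕ} {A K Y : E} {r : Res n A K} {f g : K ⟶ Y}, Fac n r f →
    Fac n r g → Fac n r (f + g)
  | 0, _, _, _, _, _, _, ⟨h, hh⟩, ⟨h', hh'⟩ => ⟨h + h', by rw [← hh, ← hh', Preadditive.comp_add]⟩
  | n + 1, _, _, _, r, f, g, h, h' => Fac.add (n := n) (r := r.2.2) h h'

lemma Fac.precomp : ∀ {n : ℕ} {A K A' K' Y : E} {r : Res n A K} {r' : Res n A' K'}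
    {a k} {f : K' ⟶ Y}, Hom n r r' a k → Fac n r' f → Fac n r (k ≫ f)
  | 0, _, _, _, _, _, _, _, _, _, _, ⟨φ, h1, _⟩, ⟨h, hh⟩ =>
    ⟨φ ≫ h, by rw [reassoc_of% h1, hh]⟩
  | n + 1, _, _, _, _, _, r, r', _, _, _, ⟨_, _, h2⟩, h => Fac.precomp (n := n) h2 h

lemma snoc_surj : ∀ {n : ℕ} {A L : E} (w : Res (n + 1) A L),
    ∃ (K : E) (r : Res n A K) (c : Conf L K), w = snoc n r c
  | 0, _, _, w => ⟨w.1, w.2.1, w.2.2, rfl⟩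
  | n + 1, A, L, ⟨K1, c1, w⟩ => by
    obtain ⟨K, r, c, rfl⟩ := snoc_surj (n := n) w
    exact ⟨K, ⟨K1, c1, r⟩, c, rfl⟩

lemma hom_snoc_iff : ∀ {n : ℕ} {A K L A' K' L' : E} (r : Res n A K) (c : Conf L K)
    (r' : Res n A' K') (c' : Conf L' K') (a k), Hom (n + 1) (snoc n r c) (snoc n r' c') a k ↔
      ∃ l, Hom n r r' a l ∧ ConfHom c c' l k
  | 0, _, _, _, _, _, _, r, c, r', c', a, k => Iff.rfl
  | n + 1, _, _, _, _, _, _, r, c, r', c', a, k => by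
    constructor
    · rintro ⟨k1, h1, h2⟩
      obtain ⟨l, h3, h4⟩ := (hom_snoc_iff (n := n) r.2.2 c r'.2.2 c' k1 k).1 h2
      exact ⟨l, ⟨k1, h1, h3⟩, h4⟩
    · rintro ⟨l, ⟨k1, h1, h3⟩, h4⟩
      exact ⟨k1, h1, (hom_snoc_iff (n := n) r.2.2 c r'.2.2 c' k1 k).2 ⟨l, h3, h4⟩⟩

lemma fac_snoc_iff : ∀ {n : ℕ} {A K L Y : E} (r : Res n A K) (c : Conf L K) (f : L ⟶ Y),
    Fac (n + 1) (snoc n r c) f ↔ ∃ h : c.P ⟶ Y, c.i ≫ h = f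
  | 0, _, _, _, _, r, c, f => Iff.rfl
  | n + 1, _, _, _, _, r, c, f => fac_snoc_iff (n := n) r.2.2 c f

/-! ### Opposites -/

def op : ∀ (n : ℕ) {A K : E}, Res n A K → Res n (Opposite.op K) (Opposite.op A)
  | 0, _, _, c => Conf.op c
  | n + 1, _, _, r => snoc n (op n r.2.2) r.2.1.op

def unop : ∀ (n : ℕ) {A K : Eᵒᵖ}, Res n A K → Res n (Opposite.unop K) (Opposite.unop A)
  | 0, _, _, c => Conf.unop c
  | n + 1, _, _, r => snoc n (unop n r.2.2) r.2.1.unop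

lemma op_snoc : ∀ (n : ℕ) {A K L : E} (r : Res n A K) (c : Conf L K),
    op (n + 1) (snoc n r c) = ⟨_, c.op, op n r⟩
  | 0, _, _, _, r, c => rfl
  | n + 1, _, _, _, r, c => by
    change snoc (n + 1) (op (n + 1) (snoc n r.2.2 c)) r.2.1.op = _
    rw [op_snoc n]; rfl

lemma unop_snoc : ∀ (n : ℕ) {A K L : Eᵒᵖ} (r : Res n A K) (c : Conf L K),
    unop (n + 1) (snoc n r c) = ⟨_, c.unop, unop n r⟩
  | 0, _, _, _, r, c => rfl
  | n + 1, _, _, _, r, c => by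
    change snoc (n + 1) (unop (n + 1) (snoc n r.2.2 c)) r.2.1.unop = _
    rw [unop_snoc n]; rfl

lemma unop_op : ∀ (n : ℕ) {A K : E} (r : Res n A K), unop n (op n r) = r
  | 0, _, _, _ => rfl
  | n + 1, _, _, r => by
    change unop (n + 1) (snoc n (op n r.2.2) r.2.1.op) = _
    rw [unop_snoc, unop_op n]; rfl

lemma op_unop : ∀ (n : ℕ) {A K : Eᵒᵖ} (r : Res n A K), op n (unop n r) = r
  | 0, _, _, _ => rfl
  | n + 1, _, _, r => by
    change op (n + 1) (snoc n (unop n r.2.2) r.2.1.unop) = _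
    rw [op_snoc, op_unop n]; rfl

lemma _root_.DCT.ConfHom.op {K A K' A' : E} {c : Conf K A} {c' : Conf K' A'} {a k}
    (h : ConfHom c c' a k) : ConfHom c'.op c.op k.op a.op := by
  obtain ⟨φ, h1, h2⟩ := h
  exact ⟨φ.op, congrArg Quiver.Hom.op h2, congrArg Quiver.Hom.op h1⟩

lemma _root_.DCT.ConfHom.unop {K A K' A' : Eᵒᵖ} {c : Conf K A} {c' : Conf K' A'} {a k}
    (h : ConfHom c c' a k) : ConfHom c'.unop c.unop k.unop a.unop := by
  obtain ⟨φ, h1, h2⟩ := h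
  exact ⟨φ.unop, congrArg Quiver.Hom.unop h2, congrArg Quiver.Hom.unop h1⟩

lemma Hom.op : ∀ {n : ℕ} {A K A' K' : E} {r : Res n A K} {r' : Res n A' K'} {a k},
    Hom n r r' a k → Hom n (op n r') (op n r) k.op a.op
  | 0, _, _, _, _, _, _, _, _, h => ConfHom.op h
  | n + 1, _, _, _, _, r, r', a, k, ⟨k1, h1, h2⟩ =>
    (hom_snoc_iff (Res.op n r'.2.2) r'.2.1.op (Res.op n r.2.2) r.2.1.op k.op a.op).2
      ⟨k1.op, Hom.op h2, h1.op⟩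

lemma Hom.unop : ∀ {n : ℕ} {A K A' K' : Eᵒᵖ} {r : Res n A K} {r' : Res n A' K'} {a k},
    Hom n r r' a k → Hom n (unop n r') (unop n r) k.unop a.unop
  | 0, _, _, _, _, _, _, _, _, h => ConfHom.unop h
  | n + 1, _, _, _, _, r, r', a, k, ⟨k1, h1, h2⟩ =>
    (hom_snoc_iff (Res.unop n r'.2.2) r'.2.1.unop (Res.unop n r.2.2) r.2.1.unop k.unop a.unop).2
      ⟨k1.unop, Hom.unop h2, h1.unop⟩

/-- Yoneda equivalence -/
def Eqv {n : ℕ} {A K : E} : Res n A K → Res n A K → Prop :=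
  Relation.EqvGen fun s t => Hom n s t (𝟙 A) (𝟙 K)

def Vanish (n : ℕ) (A K : E) : Prop := ∀ s t : Res n A K, Eqv s t

lemma Eqv.op {n : ℕ} {A K : E} {s t : Res n A K} (h : Eqv s t) : Eqv (op n s) (op n t) := by
  induction h with
  | rel _ _ h => exact .symm _ _ (.rel _ _ (Hom.op h))
  | refl => exact .refl _
  | symm _ _ _ ih => exact .symm _ _ ih
  | trans _ _ _ _ _ h1 h2 => exact .trans _ _ _ h1 h2

lemma Eqv.unop {n : ℕ} {A K : Eᵒᵖ} {s t : Res n A K} (h : Eqv s t) :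
    Eqv (unop n s) (unop n t) := by
  induction h with
  | rel _ _ h => exact .symm _ _ (.rel _ _ (Hom.unop h))
  | refl => exact .refl _
  | symm _ _ _ ih => exact .symm _ _ ih
  | trans _ _ _ _ _ h1 h2 => exact .trans _ _ _ h1 h2

lemma vanish_op_iff {n : ℕ} {A K : E} :
    Vanish n (Opposite.op K) (Opposite.op A) ↔ Vanish n A K := by
  constructor
  · intro h s t
    have := (h (op n s) (op n t)).unop
    rwa [unop_op, unop_op] at this
  · intro h s t
    have := (h (unop n s) (unop n t)).op
    rwa [op_unop, op_unop] at this

end Res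
end
end DCT

namespace DCT

open Opposite

section
set_option linter.unusedSectionVars false
variable [ExactCatStruct E] [IsExactCat E]

lemma Conf.refine {K A K0 X : E} (c : Conf K A) (g : c.P ⟶ X) (e : Conf K0 X) :
    ∃ (K' : E) (c' : Conf K' A) (ψ : c'.P ⟶ c.P) (h : c'.P ⟶ e.P) (k : K' ⟶ K),
      c'.i ≫ ψ = k ≫ c.i ∧ ψ ≫ c.p = c'.p ∧ ψ ≫ g = h ≫ e.p := by
  obtain ⟨e', φ, H, _⟩ := e.pullback g
  obtain ⟨K', i', w', hm⟩ := IsExactCat.comp_deflation e'.p c.p e'.deflation c.deflation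
  obtain ⟨k, hk⟩ := c.lift (i' ≫ e'.p) (by rw [Category.assoc, w'])
  exact ⟨K', ⟨e'.P, i', e'.p ≫ c.p, w', hm⟩, e'.p, φ, k, hk.symm, rfl, H.w.symm⟩

lemma Conf.lift2 {K A L A' : E} (c : Conf L A') (t : Conf K A) (a : A' ⟶ A) :
    ∃ (K' : E) (c' : Conf K' A') (k : K' ⟶ L) (k' : K' ⟶ K),
      ConfHom c' c (𝟙 A') k ∧ ConfHom c' t a k' := by
  obtain ⟨K', c', ψ, h, k, h1, h2, h3⟩ := c.refine (c.p ≫ a) t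
  obtain ⟨k', hk'⟩ := t.lift (c'.i ≫ h) (by
    rw [Category.assoc, ← h3, reassoc_of% h2, Conf.w_assoc])
  exact ⟨K', c', k, k', ⟨ψ, h1, by simp [h2]⟩, ⟨h, hk'.symm, by rw [← h3, reassoc_of% h2]⟩⟩

lemma ConfHom.push {K A K' A' L : E} {r : Conf K A} {c' : Conf K' A} {k : K ⟶ K'}
    {φ : r.P ⟶ c'.P} (H : IsPushout r.i k φ c'.i) (h : φ ≫ c'.p = r.p) (t : Conf L A')
    (a : A ⟶ A') (k' : K' ⟶ L) (hr : ConfHom r t a (k ≫ k')) : ConfHom c' t a k' := by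
  obtain ⟨ψ, h1, h2⟩ := hr
  have w : r.i ≫ ψ = k ≫ k' ≫ t.i := by rw [h1, Category.assoc]
  refine ⟨H.desc ψ (k' ≫ t.i) w, H.inr_desc _ _ _, ?_⟩
  apply H.hom_ext
  · rw [H.inl_desc_assoc, h2, reassoc_of% h]
  · simp

lemma ConfHom.of_lift {K A K' A' : E} (r : Conf K A) (r' : Conf K' A') (g : A ⟶ r'.P) :
    ConfHom r r' (g ≫ r'.p) 0 := ⟨r.p ≫ g, by simp, by simp⟩

lemma ConfHom.of_section {K A K' : E} (r : Conf K A) (r' : Conf K' A) (g : A ⟶ r'.P)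
    (h : g ≫ r'.p = 𝟙 A) : ConfHom r r' (𝟙 A) 0 := by
  rw [← h]; exact ConfHom.of_lift r r' g

lemma ConfHom.of_retraction {K A A' : E} (r : Conf K A) (r' : Conf K A') (h : r.P ⟶ K)
    (hh : r.i ≫ h = 𝟙 K) : ConfHom r r' 0 (𝟙 K) :=
  ⟨h ≫ r'.i, by rw [reassoc_of% hh, Category.id_comp], by simp⟩

lemma ConfHom.null {K A K' A' : E} {u : Conf K A} {t : Conf K' A'} {k : K ⟶ K'}
    (h : ConfHom u t 0 k) : ∃ g : u.P ⟶ K', u.i ≫ g = k := by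
  obtain ⟨φ, h1, h2⟩ := h
  obtain ⟨g, hg⟩ := t.lift φ (by rw [h2, comp_zero])
  exact ⟨g, by rw [← cancel_mono t.i, Category.assoc, hg, h1]⟩

namespace Res

lemma exists_pullback : ∀ {n : ℕ} {A A' K : E} (r : Res n A K) (a : A' ⟶ A),
    ∃ r' : Res n A' K, Hom n r' r a (𝟙 K)
  | 0, _, _, _, r, a => by
    obtain ⟨c', φ, H, h⟩ := Conf.pullback r a
    exact ⟨c', φ, by simp [h], H.w⟩
  | n + 1, _, _, _, ⟨K1, c, r⟩, a => by
    obtain ⟨c', φ, H, h⟩ := Conf.pullback c a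
    exact ⟨⟨K1, c', r⟩, 𝟙 _, ⟨φ, by simp [h], H.w⟩, Hom.id n r⟩

lemma exists_pushout : ∀ {n : ℕ} {A K K' : E} (r : Res n A K) (k : K ⟶ K'),
    ∃ r' : Res n A K', Hom n r r' (𝟙 A) k ∧
      (∀ {B L : E} (t : Res n B L) (a : A ⟶ B) (k' : K' ⟶ L), Hom n r t a (k ≫ k') →
        Hom n r' t a k') ∧ (Fac n r k → Fac n r' (𝟙 K'))
  | 0, _, _, _, r, k => by
    obtain ⟨c', φ, H, h⟩ := Conf.pushout r k
    refine ⟨c', ⟨φ, H.w, by simp [h]⟩, ?_, ?_⟩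
    · exact fun t a k' hr => ConfHom.push H h t a k' hr
    · rintro ⟨g, hg⟩
      have w : Conf.i r ≫ g = k ≫ 𝟙 _ := by rw [hg, Category.comp_id]
      exact ⟨H.desc g (𝟙 _) w, H.inr_desc _ _ _⟩
  | n + 1, _, _, _, ⟨K1, c, r⟩, k => by
    obtain ⟨r', h1, h2, h3⟩ := exists_pushout (n := n) r k
    refine ⟨⟨K1, c, r'⟩, ⟨𝟙 _, ConfHom.id c, h1⟩, ?_, h3⟩
    rintro B L t a k' ⟨k1, h4, h5⟩
    exact ⟨k1, h4, h2 _ _ _ h5⟩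

lemma exists_lift : ∀ {n : ℕ} {A K A' L : E} (t : Res n A K) (u : Res n A' L) (a : A' ⟶ A),
    ∃ (L' : E) (u' : Res n A' L') (l : L' ⟶ L) (k : L' ⟶ K),
      Hom n u' u (𝟙 A') l ∧ Hom n u' t a k
  | 0, _, _, _, _, t, u, a => Conf.lift2 u t a
  | n + 1, _, _, _, _, ⟨T1, ct, t⟩, ⟨U1, cu, u⟩, a => by
    obtain ⟨K', c', k, k', h1, h2⟩ := Conf.lift2 cu ct a
    obtain ⟨u', h3⟩ := exists_pullback u k
    obtain ⟨L', u'', l, m, h4, h5⟩ := exists_lift t u' k'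
    have := h4.comp h3
    rw [Category.id_comp, Category.comp_id] at this
    exact ⟨L', ⟨K', c', u''⟩, l, m, ⟨k, h1, this⟩, ⟨k', h2, h5⟩⟩

def hd : ∀ (n : ℕ) {A K : E}, Res n A K → Σ L : E, Conf L A
  | 0, _, K, c => ⟨K, c⟩
  | _ + 1, _, _, r => ⟨r.1, r.2.1⟩

lemma hom_of_hd_lift : ∀ {n : ℕ} {A K A' K' : E} (r : Res n A K) (r' : Res n A' K')
    (g : A ⟶ (hd n r').2.P), Hom n r r' (g ≫ (hd n r').2.p) 0
  | 0, _, _, _, _, r, r', g =>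
    ConfHom.of_lift (r : Conf _ _) (r' : Conf _ _) g
  | n + 1, _, _, _, _, ⟨_, c, _⟩, ⟨_, c', _⟩, g =>
    ⟨0, ConfHom.of_lift c c' g, Hom.zero n _ _⟩

lemma exists_homotopy : ∀ {n : ℕ} {A K A' L : E} (u : Res n A' L) (t : Res n A K) (k : L ⟶ K),
    Hom n u t 0 k → ∃ (L' : E) (u' : Res n A' L') (l : L' ⟶ L),
      Hom n u' u (𝟙 A') l ∧ Fac n u' (l ≫ k)
  | 0, _, _, _, L, u, t, k, h => by
    obtain ⟨g, hg⟩ := ConfHom.null h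
    exact ⟨L, u, 𝟙 L, Hom.id 0 u, g, by rw [hg, Category.id_comp]⟩
  | n + 1, _, _, _, _, ⟨U1, cu, u⟩, ⟨T1, ct, t⟩, k, ⟨k1, ⟨φ, h1, h2⟩, h3⟩ => by
    dsimp only at h1 h2 h3 k1
    obtain ⟨h, hh⟩ := ct.lift φ (by rw [h2, comp_zero])
    have hk1 : cu.i ≫ h = k1 := by
      rw [← cancel_mono ct.i, Category.assoc, hh, h1]
    obtain ⟨U', c', ψ, h', k0, e1, e2, e3⟩ := cu.refine h (hd n t).2
    obtain ⟨u', h4⟩ := exists_pullback u k0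
    have h5 := (h4.comp h3).sub (hom_of_hd_lift u' t (c'.i ≫ h'))
    have h6 : k0 ≫ k1 - (c'.i ≫ h') ≫ (hd n t).2.p = 0 := by
      rw [Category.assoc, ← e3, ← hk1, reassoc_of% e1, sub_self]
    rw [h6, Category.id_comp, sub_zero] at h5
    obtain ⟨L', u'', l, h7, h8⟩ := exists_homotopy u' t k h5
    have := h7.comp h4
    rw [Category.id_comp, Category.comp_id] at this
    exact ⟨L', ⟨U', c', u''⟩, l, ⟨k0, ⟨ψ, e1, by simp [e2]⟩, this⟩, h8⟩

lemma fac_lift : ∀ {n : ℕ} {A K X K0 : E} (r : Res n A K) (f : K ⟶ X) (d : Conf K0 X),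
    Fac n r f → ∃ (K' : E) (r' : Res n A K') (l : K' ⟶ K) (e : K' ⟶ d.P),
      Hom n r' r (𝟙 A) l ∧ e ≫ d.p = l ≫ f
  | 0, _, _, _, _, r, f, d, ⟨g, hg⟩ => by
    obtain ⟨K', c', ψ, h, k, h1, h2, h3⟩ := Conf.refine r g d
    exact ⟨K', c', k, c'.i ≫ h, ⟨ψ, h1, by simp [h2]⟩, by
      rw [Category.assoc, ← h3, reassoc_of% h1, hg]⟩
  | n + 1, _, _, _, _, ⟨K1, c, r⟩, f, d, h => by
    obtain ⟨K', r', l, e, h1, h2⟩ := fac_lift (n := n) r f d h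
    exact ⟨K', ⟨K1, c, r'⟩, l, e, ⟨𝟙 _, ConfHom.id c, h1⟩, h2⟩

/-- The class of the roof `(r, f)` is zero. -/
def Zero (n : ℕ) {A K Y : E} (r : Res n A K) (f : K ⟶ Y) : Prop :=
  ∃ (K' : E) (r' : Res n A K') (k : K' ⟶ K), Hom n r' r (𝟙 A) k ∧ Fac n r' (k ≫ f)

lemma Fac.zero {n : ℕ} {A K Y : E} {r : Res n A K} {f : K ⟶ Y} (h : Fac n r f) : Zero n r f :=
  ⟨K, r, 𝟙 K, Hom.id n r, by rwa [Category.id_comp]⟩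

lemma Zero.comp {n : ℕ} {A K Y Y' : E} {r : Res n A K} {f : K ⟶ Y} (h : Zero n r f)
    (g : Y ⟶ Y') : Zero n r (f ≫ g) := by
  obtain ⟨K', r', k, h1, h2⟩ := h
  exact ⟨K', r', k, h1, by rw [← Category.assoc]; exact h2.comp g⟩

lemma Zero.of_hom {n : ℕ} {A K L Y : E} {u : Res n A L} {t : Res n A K} {k : L ⟶ K} {f : K ⟶ Y}
    (h : Hom n u t (𝟙 A) k) (hz : Zero n u (k ≫ f)) : Zero n t f := by
  obtain ⟨K', r', k', h1, h2⟩ := hz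
  have := h1.comp h
  rw [Category.id_comp] at this
  exact ⟨K', r', k' ≫ k, this, by rwa [Category.assoc]⟩

lemma Zero.pre_hom {n : ℕ} {A K L Y : E} {u : Res n A L} {t : Res n A K} {k : L ⟶ K} {f : K ⟶ Y}
    (h : Hom n u t (𝟙 A) k) (hz : Zero n t f) : Zero n u (k ≫ f) := by
  obtain ⟨K', t', k', h1, h2⟩ := hz
  obtain ⟨L', u', l, m, h3, h4⟩ := exists_lift t' u (𝟙 A)
  have h5 := (h3.comp h).sub (h4.comp h1)
  rw [sub_self] at h5
  obtain ⟨L'', u'', l', h6, h7⟩ := exists_homotopy u' t _ h5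
  refine Zero.of_hom h3 ?_
  refine Zero.of_hom h6 ?_
  apply Fac.zero
  have h8 := (h7.comp f).add (Fac.precomp h6 (Fac.precomp h4 h2))
  have : (l' ≫ (l ≫ k - m ≫ k')) ≫ f + l' ≫ m ≫ k' ≫ f = l' ≫ l ≫ k ≫ f := by
    simp
  rwa [this] at h8

/-- All roofs vanish. -/
def Van (n : ℕ) (A Y : E) : Prop := ∀ (K : E) (r : Res n A K) (f : K ⟶ Y), Zero n r f

lemma exists_trivial : ∀ (n : ℕ) (A Y : E), ∃ t : Res n A Y, Fac n t (𝟙 Y) ∧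
    ∀ {K : E} (q : Res n A K), Hom n q t (𝟙 A) 0
  | 0, A, Y => by
    obtain ⟨c, σ, h, h1, h2, _, _⟩ := exists_split Y A
    refine ⟨c, ⟨h, h2⟩, fun q => ConfHom.of_section q c σ h1⟩
  | n + 1, A, Y => by
    obtain ⟨Z, hZ⟩ := exists_isZero A
    obtain ⟨t, h1, _⟩ := exists_trivial n Z Y
    refine ⟨⟨Z, confZero hZ A, t⟩, h1, fun ⟨_, c, q⟩ => ⟨0,
      ConfHom.of_section c (confZero hZ A) (𝟙 A) (Category.id_comp _), Hom.zero n _ _⟩⟩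

lemma hom_of_fac : ∀ {n : ℕ} {A Y A' : E} (q : Res n A Y) (t : Res n A' Y), Fac n q (𝟙 Y) →
    Hom n q t 0 (𝟙 Y)
  | 0, _, _, _, q, t, ⟨h, hh⟩ => ConfHom.of_retraction q t h hh
  | n + 1, _, _, _, ⟨_, c, q⟩, ⟨_, c', t⟩, h => ⟨0, ConfHom.zero _ _, hom_of_fac (n := n) q t h⟩

lemma van_iff_vanish {n : ℕ} {A Y : E} : Van n A Y ↔ Vanish n A Y := by
  constructor
  · intro h
    obtain ⟨t0, h0, h0'⟩ := exists_trivial n A Y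
    have key : ∀ s : Res n A Y, Eqv s t0 := by
      intro s
      obtain ⟨K', r', k, h1, h2⟩ := h _ s (𝟙 Y)
      rw [Category.comp_id] at h2
      obtain ⟨q, h3, h4, h5⟩ := exists_pushout r' k
      have h6 := h4 s (𝟙 A) (𝟙 Y) (by rwa [Category.comp_id])
      have h7 := (hom_of_fac q t0 (h5 h2)).add (h0' q)
      rw [zero_add, add_zero] at h7
      exact .trans _ _ _ (.symm _ _ (.rel _ _ h6)) (.rel _ _ h7)
    exact fun s t => .trans _ _ _ (key s) (.symm _ _ (key t))
  · intro h K r f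
    obtain ⟨r', h1, _, _⟩ := exists_pushout r f
    obtain ⟨t0, h0, h0'⟩ := exists_trivial n A Y
    have key : ∀ s t : Res n A Y, Eqv s t → (Zero n s (𝟙 Y) ↔ Zero n t (𝟙 Y)) := by
      intro s t h
      induction h with
      | rel _ _ h =>
        exact ⟨fun hz => Zero.of_hom h (by rwa [Category.id_comp]), fun hz => by
          have := Zero.pre_hom h hz
          rwa [Category.id_comp] at this⟩
      | refl => exact Iff.rfl
      | symm _ _ _ ih => exact ih.symm
      | trans _ _ _ _ _ h1 h2 => exact h1.trans h2
    have := Zero.pre_hom h1 ((key r' t0 (h _ _)).2 h0.zero)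
    rwa [Category.comp_id] at this

lemma van_op_iff {n : ℕ} {A K : E} : Van n (Opposite.op K) (Opposite.op A) ↔ Van n A K := by
  rw [van_iff_vanish, van_iff_vanish, vanish_op_iff]

lemma Van.of_iso {n : ℕ} {A Y Y' : E} (h : Van n A Y) (e : Y ≅ Y') : Van n A Y' := by
  intro K r f
  have := (h K r (f ≫ e.inv)).comp e.hom
  rwa [Category.assoc, e.inv_hom_id, Category.comp_id] at this

lemma van_iso_iff {n : ℕ} {A Y Y' : E} (e : Y ≅ Y') : Van n A Y ↔ Van n A Y' :=
  ⟨fun h => h.of_iso e, fun h => h.of_iso e.symm⟩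

lemma van_iso_iff' {n : ℕ} {A A' Y : E} (e : A ≅ A') : Van n A Y ↔ Van n A' Y := by
  rw [← van_op_iff, ← van_op_iff (A := A'), van_iso_iff e.symm.op]

/-- The middle term of a split conflation. -/
lemma van_split {n : ℕ} {A Y Z P : E} (p : P ⟶ Z) (σ : Z ⟶ P) (h : P ⟶ Y) (i : Y ⟶ P)
    (hs : p ≫ σ + h ≫ i = 𝟙 P) (hY : Van n A Y) (hZ : Van n A Z) : Van n A P := by
  intro K r f
  obtain ⟨K', r', k, h1, h2⟩ := hY K r (f ≫ h)
  refine Zero.of_hom h1 ?_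
  obtain ⟨K'', r'', k', h3, h4⟩ := hZ K' r' (k ≫ f ≫ p)
  refine Zero.of_hom h3 (Fac.zero ?_)
  have h5 := (h4.comp σ).add ((Fac.precomp h3 h2).comp i)
  have : (k' ≫ k ≫ f ≫ p) ≫ σ + (k' ≫ k ≫ f ≫ h) ≫ i = k' ≫ k ≫ f := by
    simp only [Category.assoc, ← Preadditive.comp_add, hs, Category.comp_id]
  rwa [this] at h5

/-- Exactness of `Ext^j(A,M) → Ext^j(A,X) → Ext^{j+1}(A,K)`. -/
lemma van_a {n : ℕ} {A K X : E} (d : Conf K X) (h1 : Van n A d.P) (h2 : Van (n + 1) A K) :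
    Van n A X := by
  intro L u f
  obtain ⟨d', φ, H, hφ⟩ := d.pullback f
  obtain ⟨K', w', k, h3, h4⟩ := h2 _ (snoc n u d') (𝟙 K)
  obtain ⟨Z', u', c, rfl⟩ := snoc_surj w'
  rw [hom_snoc_iff] at h3
  rw [fac_snoc_iff] at h4
  obtain ⟨l, hl, ψ, e1, e2⟩ := h3
  obtain ⟨h, hh⟩ := h4
  rw [Category.comp_id] at hh
  obtain ⟨g, hg⟩ := c.desc (ψ - h ≫ d'.i) (by
    rw [Preadditive.comp_sub, e1, reassoc_of% hh, sub_self])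
  have hgl : g ≫ d'.p = l := by
    rw [← cancel_epi c.p, reassoc_of% hg, Preadditive.sub_comp, e2]
    simp
  have h5 := (h1 _ u' (g ≫ φ)).comp d.p
  rw [Category.assoc, H.w, reassoc_of% hgl] at h5
  exact Zero.of_hom hl h5

/-- Exactness of `Ext^j(A,X) → Ext^{j+1}(A,K) → Ext^{j+1}(A,M)`. -/
lemma van_b {n : ℕ} {A K X : E} (d : Conf K X) (h1 : Van n A X) (h2 : Van (n + 1) A d.P) :
    Van (n + 1) A K := by
  intro L u f
  obtain ⟨K', w', k, h3, h4⟩ := h2 _ u (f ≫ d.i)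
  refine Zero.of_hom h3 ?_
  obtain ⟨Z, v, c, rfl⟩ := snoc_surj w'
  rw [fac_snoc_iff] at h4
  obtain ⟨h, hh⟩ := h4
  obtain ⟨g, hg⟩ := c.desc (h ≫ d.p) (by rw [reassoc_of% hh]; simp)
  obtain ⟨Z', v', l, h5, h6⟩ := h1 _ v g
  obtain ⟨Z'', v'', l', e, h7, h8⟩ := fac_lift v' (l ≫ g) d h6
  obtain ⟨c', ψ, H, hψ⟩ := c.pullback (l' ≫ l)
  have h9 : Hom (n + 1) (snoc n v'' c') (snoc n v c) (𝟙 A) (𝟙 K') := by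
    rw [hom_snoc_iff]
    have := h7.comp h5
    rw [Category.id_comp] at this
    exact ⟨_, this, ψ, by simp [hψ], H.w⟩
  refine Zero.of_hom h9 (Fac.zero ?_)
  rw [fac_snoc_iff, Category.id_comp]
  obtain ⟨h', hh'⟩ := d.lift (ψ ≫ h - c'.p ≫ e) (by
    rw [Preadditive.sub_comp, Category.assoc, Category.assoc, ← hg, h8, H.w_assoc]
    simp)
  refine ⟨h', ?_⟩
  rw [← cancel_mono d.i, Category.assoc, hh', Preadditive.comp_sub, reassoc_of% hψ, hh]
  simp

lemma van_b0 {A K X : E} (d : Conf K X) (h1 : ∀ g : A ⟶ X, ∃ g' : A ⟶ d.P, g' ≫ d.p = g)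
    (h2 : Van 0 A d.P) : Van 0 A K := by
  intro L u f
  obtain ⟨K', c, k, h3, h4⟩ := h2 _ u (f ≫ d.i)
  refine Zero.of_hom h3 (Fac.zero ?_)
  obtain ⟨h, hh⟩ := h4
  change Conf K' A at c
  obtain ⟨g, hg⟩ := c.desc (h ≫ d.p) (by rw [reassoc_of% hh]; simp)
  obtain ⟨g', hg'⟩ := h1 g
  obtain ⟨h', hh'⟩ := d.lift (h - c.p ≫ g') (by
    rw [Preadditive.sub_comp, Category.assoc, hg', hg, sub_self])
  refine ⟨h', ?_⟩
  rw [← cancel_mono d.i, Category.assoc, hh', Preadditive.comp_sub, hh]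
  simp

end Res
end
end DCT

namespace DCT

open Opposite

section
set_option linter.unusedSectionVars false
set_option linter.unusedVariables false
variable [ExactCatStruct E] [IsExactCat E]

/-! ### Comparison with the sequences of the statement -/

def nilOb (X Z : E) : ℕ → E
  | 0 => X
  | 1 => X
  | _ + 2 => Z

def nilZ (X Z : E) : ℕ → E
  | 0 => X
  | _ + 1 => Z

def nilπ (X Z : E) : ∀ i, nilOb X Z (i + 1) ⟶ nilZ X Z i
  | 0 => 𝟙 X
  | _ + 1 => 𝟙 Z

def nilι (X Z : E) : ∀ i, nilZ X Z i ⟶ nilOb X Z i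
  | 0 => 𝟙 X
  | 1 => 0
  | _ + 2 => 0

/-- The degenerate sequence. -/
def seqNil (X : E) {Z : E} (hZ : IsZero Z) : EExtSeq E 0 X X where
  ob := nilOb X Z
  Z := nilZ X Z
  π := nilπ X Z
  ι := nilι X Z
  iso0 := Iso.refl X
  isoTop := Iso.refl X
  ob_zero
    | 0, h => absurd h (by omega)
    | 1, h => absurd h (by omega)
    | _ + 2, _ => hZ
  Z_zero
    | 0, h => absurd h (by omega)
    | _ + 1, _ => hZ
  w
    | 0 => zero_comp
    | _ + 1 => zero_comp
  confl
    | 0 => (confZero hZ X).mem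
    | _ + 1 => (confZero hZ Z).mem
  iso_bot := inferInstanceAs (IsIso (𝟙 X))

section cons
variable {n : ℕ} {X K Y : E} (c : Conf K X) (s : EExtSeq E n K Y)

def consOb : ℕ → E
  | 0 => X
  | 1 => c.P
  | i + 2 => s.ob (i + 1)

def consZ : ℕ → E
  | 0 => X
  | i + 1 => s.Z i

def consπ : ∀ i, consOb c s (i + 1) ⟶ consZ (X := X) s i
  | 0 => c.p
  | i + 1 => s.π i

def consι : ∀ i, consZ (X := X) s i ⟶ consOb c s i
  | 0 => 𝟙 X
  | 1 => s.ι 0 ≫ s.iso0.hom ≫ c.i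
  | i + 2 => s.ι (i + 1)

noncomputable def isoBot {n : ℕ} {X Y : E} (s : EExtSeq E n X Y) : s.Z 0 ≅ X :=
  haveI := s.iso_bot
  (asIso (s.ι 0)) ≪≫ s.iso0

lemma isoBot_hom {n : ℕ} {X Y : E} (s : EExtSeq E n X Y) :
    (isoBot s).hom = s.ι 0 ≫ s.iso0.hom := rfl

def seqCons : EExtSeq E (n + 1) X Y where
  ob := consOb c s
  Z := consZ s
  π := consπ c s
  ι := consι c s
  iso0 := Iso.refl X
  isoTop := s.isoTop
  ob_zero
    | 0, h => absurd h (by omega)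
    | 1, h => absurd h (by omega)
    | i + 2, h => s.ob_zero (i + 1) (by omega)
  Z_zero
    | 0, h => absurd h (by omega)
    | i + 1, h => s.Z_zero i (by omega)
  w
    | 0 => by
      change (s.ι 0 ≫ s.iso0.hom ≫ c.i) ≫ c.p = 0
      simp
    | i + 1 => s.w i
  confl
    | 0 => (c.iso (isoBot s) (Iso.refl _) (Iso.refl _) (s.ι 0 ≫ s.iso0.hom ≫ c.i) c.p
        (by simp [isoBot_hom]) (by simp)).mem
    | i + 1 => s.confl i
  iso_bot := inferInstanceAs (IsIso (𝟙 X))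

end cons

section tail
variable {n : ℕ} {X Y : E} (s : EExtSeq E (n + 1) X Y)

def tailOb : ℕ → E
  | 0 => s.Z 1
  | i + 1 => s.ob (i + 2)

def tailι : ∀ i, s.Z (i + 1) ⟶ tailOb s i
  | 0 => 𝟙 _
  | i + 1 => s.ι (i + 2)

def seqTail : EExtSeq E n (s.Z 1) Y where
  ob := tailOb s
  Z i := s.Z (i + 1)
  π i := s.π (i + 1)
  ι := tailι s
  iso0 := Iso.refl _
  isoTop := s.isoTop
  ob_zero
    | 0, h => absurd h (by omega)
    | i + 1, h => s.ob_zero (i + 2) (by omega)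
  Z_zero i h := s.Z_zero (i + 1) (by omega)
  w i := s.w (i + 1)
  confl i := s.confl (i + 1)
  iso_bot := inferInstanceAs (IsIso (𝟙 _))

end tail

/-- The conflations making up a sequence. -/
def seqConf {n : ℕ} {X Y : E} (s : EExtSeq E n X Y) (i : ℕ) : Conf (s.Z (i + 1)) (s.Z i) where
  P := s.ob (i + 1)
  i := s.ι (i + 1)
  p := s.π i
  w := s.w i
  mem := s.confl i

noncomputable def seqHead {n : ℕ} {X Y : E} (s : EExtSeq E n X Y) : Conf (s.Z 1) X :=
  (seqConf s 0).iso (Iso.refl _) (Iso.refl _) (isoBot s).symm (s.ι 1)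
    (s.π 0 ≫ s.ι 0 ≫ s.iso0.hom) (by simp [seqConf]) (by simp [seqConf, ← isoBot_hom])

instance seqπ_iso {n : ℕ} {X Y : E} (s : EExtSeq E n X Y) : IsIso (s.π n) := by
  have h0 : s.ι (n + 1) = 0 := (s.Z_zero (n + 1) (by omega)).eq_of_src _ _
  obtain ⟨g, hg⟩ := (seqConf s n).desc (𝟙 (s.ob (n + 1))) (by simp [seqConf, h0])
  change s.π n ≫ g = 𝟙 _ at hg
  refine ⟨g, hg, ?_⟩
  have : Epi (s.π n) := (seqConf s n).epi_p
  rw [← cancel_epi (s.π n), reassoc_of% hg, Category.comp_id]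

noncomputable def isoTopZ {n : ℕ} {X Y : E} (s : EExtSeq E n X Y) : Y ≅ s.Z n :=
  s.isoTop.symm ≪≫ asIso (s.π n)

lemma isoTopZ_hom {n : ℕ} {X Y : E} (s : EExtSeq E n X Y) :
    (isoTopZ s).hom = s.isoTop.inv ≫ s.π n := rfl

noncomputable def seqLast {X Y : E} (s : EExtSeq E 1 X Y) : Conf Y X :=
  (seqHead s).iso (isoTopZ s) (Iso.refl _) (Iso.refl _) (s.isoTop.inv ≫ s.π 1 ≫ s.ι 1)
    (s.π 0 ≫ s.ι 0 ≫ s.iso0.hom) (by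
      simp [isoTopZ_hom, seqHead, Conf.iso]
      exact (Category.assoc _ _ _).symm)
    (by simp [seqHead, Conf.iso])

noncomputable def ofSeq : ∀ (n : ℕ) {X Y : E}, EExtSeq E (n + 1) X Y → Res n X Y
  | 0, _, _, s => seqLast s
  | n + 1, _, _, s => ⟨s.Z 1, seqHead s, ofSeq n (seqTail s)⟩

def toSeq {Z : E} (hZ : IsZero Z) : ∀ (n : ℕ) {X Y : E}, Res n X Y → EExtSeq E (n + 1) X Y
  | 0, _, Y, c => seqCons c (seqNil Y hZ)
  | n + 1, _, _, r => seqCons r.2.1 (toSeq hZ n r.2.2)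

/-- Morphisms of sequences with arbitrary end components. -/
structure GHom {n : ℕ} {X Y X' Y' : E} (s : EExtSeq E n X Y) (t : EExtSeq E n X' Y')
    (a : X ⟶ X') (k : Y ⟶ Y') where
  φ : ∀ i, s.ob i ⟶ t.ob i
  comm : ∀ i, (s.π i ≫ s.ι i) ≫ φ i = φ (i + 1) ≫ t.π i ≫ t.ι i
  φ0 : φ 0 = s.iso0.hom ≫ a ≫ t.iso0.inv
  φTop : φ (n + 1) = s.isoTop.hom ≫ k ≫ t.isoTop.inv

def GHom.toHom {n : ℕ} {X Y : E} {s t : EExtSeq E n X Y} (h : GHom s t (𝟙 X) (𝟙 Y)) :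
    EExtSeqHom s t where
  φ := h.φ
  comm := h.comm
  φ0 := by rw [h.φ0, Category.id_comp]
  φTop := by rw [h.φTop, Category.id_comp]

def GHom.ofHom {n : ℕ} {X Y : E} {s t : EExtSeq E n X Y} (h : EExtSeqHom s t) :
    GHom s t (𝟙 X) (𝟙 Y) where
  φ := h.φ
  comm := h.comm
  φ0 := by rw [h.φ0, Category.id_comp]
  φTop := by rw [h.φTop, Category.id_comp]

section
variable {n : ℕ} {X Y X' Y' : E} {s : EExtSeq E n X Y} {t : EExtSeq E n X' Y'}
    {a : X ⟶ X'} {k : Y ⟶ Y'}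

lemma GHom.exists_Z1 (h : GHom s t a k) :
    ∃ ζ : s.Z 1 ⟶ t.Z 1, ζ ≫ t.ι 1 = s.ι 1 ≫ h.φ 1 := by
  refine (seqConf t 0).lift (s.ι 1 ≫ h.φ 1) ?_
  change (s.ι 1 ≫ h.φ 1) ≫ t.π 0 = 0
  have := t.iso_bot
  rw [← cancel_mono (t.ι 0), Category.assoc, Category.assoc, ← h.comm 0, Category.assoc,
    ← Category.assoc (s.ι 1), s.w 0]
  simp

lemma GHom.head (h : GHom s t a k) (ζ : s.Z 1 ⟶ t.Z 1) (hζ : ζ ≫ t.ι 1 = s.ι 1 ≫ h.φ 1) :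
    ConfHom (seqHead s) (seqHead t) a ζ := by
  refine ⟨h.φ 1, hζ.symm, ?_⟩
  change h.φ 1 ≫ t.π 0 ≫ t.ι 0 ≫ t.iso0.hom = (s.π 0 ≫ s.ι 0 ≫ s.iso0.hom) ≫ a
  have h1 := h.comm 0
  rw [h.φ0] at h1
  have h2 := congrArg (· ≫ t.iso0.hom) h1
  simp only [Category.assoc, Iso.inv_hom_id, Category.comp_id] at h2
  simp only [Category.assoc]
  exact h2.symm

end

def tailφ {n : ℕ} {X Y X' Y' : E} {s : EExtSeq E (n + 1) X Y} {t : EExtSeq E (n + 1) X' Y'}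
    {a : X ⟶ X'} {k : Y ⟶ Y'} (h : GHom s t a k) (ζ : s.Z 1 ⟶ t.Z 1) :
    ∀ i, (seqTail s).ob i ⟶ (seqTail t).ob i
  | 0 => ζ
  | i + 1 => h.φ (i + 2)

def GHom.tail {n : ℕ} {X Y X' Y' : E} {s : EExtSeq E (n + 1) X Y} {t : EExtSeq E (n + 1) X' Y'}
    {a : X ⟶ X'} {k : Y ⟶ Y'} (h : GHom s t a k) (ζ : s.Z 1 ⟶ t.Z 1)
    (hζ : ζ ≫ t.ι 1 = s.ι 1 ≫ h.φ 1) : GHom (seqTail s) (seqTail t) ζ k where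
  φ := tailφ h ζ
  comm
    | 0 => by
      change (s.π 1 ≫ 𝟙 _) ≫ ζ = h.φ 2 ≫ t.π 1 ≫ 𝟙 _
      have : Mono (t.ι 1) := (seqConf t 0).mono_i
      rw [Category.comp_id, Category.comp_id, ← cancel_mono (t.ι 1), Category.assoc,
        Category.assoc, hζ, ← h.comm 1, Category.assoc]
    | i + 1 => h.comm (i + 2)
  φ0 := by
    change ζ = 𝟙 _ ≫ ζ ≫ 𝟙 _
    simp
  φTop := h.φTop

lemma GHom.last {X Y X' Y' : E} {s : EExtSeq E 1 X Y} {t : EExtSeq E 1 X' Y'}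
    {a : X ⟶ X'} {k : Y ⟶ Y'} (h : GHom s t a k) : ConfHom (seqLast s) (seqLast t) a k := by
  obtain ⟨ζ, hζ⟩ := h.exists_Z1
  obtain ⟨_, h2⟩ := h.head ζ hζ
  refine ⟨h.φ 1, ?_, ?_⟩
  · change (s.isoTop.inv ≫ s.π 1 ≫ s.ι 1) ≫ h.φ 1 = k ≫ t.isoTop.inv ≫ t.π 1 ≫ t.ι 1
    have h1 := h.comm 1
    rw [h.φTop] at h1
    rw [Category.assoc, h1]
    simp
  · change h.φ 1 ≫ t.π 0 ≫ t.ι 0 ≫ t.iso0.hom = (s.π 0 ≫ s.ι 0 ≫ s.iso0.hom) ≫ a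
    have h1 := h.comm 0
    rw [h.φ0] at h1
    have h2 := congrArg (· ≫ t.iso0.hom) h1
    simp only [Category.assoc, Iso.inv_hom_id, Category.comp_id] at h2
    simp only [Category.assoc]
    exact h2.symm

lemma GHom.ofSeq : ∀ {n : ℕ} {X Y X' Y' : E} {s : EExtSeq E (n + 1) X Y}
    {t : EExtSeq E (n + 1) X' Y'} {a : X ⟶ X'} {k : Y ⟶ Y'}, GHom s t a k →
    Res.Hom n (ofSeq n s) (ofSeq n t) a k
  | 0, _, _, _, _, _, _, _, _, h => h.last
  | n + 1, _, _, _, _, _, _, _, _, h => by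
    obtain ⟨ζ, hζ⟩ := h.exists_Z1
    exact ⟨ζ, h.head ζ hζ, GHom.ofSeq (h.tail ζ hζ)⟩

section
variable {n : ℕ} {X K Y X' K' Y' : E} {c : Conf K X} {c' : Conf K' X'}
    {s : EExtSeq E n K Y} {t : EExtSeq E n K' Y'}

def consφ (a : X ⟶ X') (ψ : c.P ⟶ c'.P) (φ : ∀ i, s.ob i ⟶ t.ob i) :
    ∀ i, (seqCons c s).ob i ⟶ (seqCons c' t).ob i
  | 0 => a
  | 1 => ψ
  | i + 2 => φ (i + 1)

lemma GHom.cons {a : X ⟶ X'} {k1 : K ⟶ K'} {k : Y ⟶ Y'}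
    (hc : ConfHom c c' a k1) (h : GHom s t k1 k) :
    Nonempty (GHom (seqCons c s) (seqCons c' t) a k) := by
  obtain ⟨ψ, h1, h2⟩ := hc
  refine ⟨⟨consφ a ψ h.φ, ?_, ?_, h.φTop⟩⟩
  · rintro (_ | _ | i)
    · change (c.p ≫ 𝟙 _) ≫ a = ψ ≫ c'.p ≫ 𝟙 _
      simp [h2]
    · change (s.π 0 ≫ s.ι 0 ≫ s.iso0.hom ≫ c.i) ≫ ψ
        = h.φ 1 ≫ t.π 0 ≫ t.ι 0 ≫ t.iso0.hom ≫ c'.i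
      have h3 := h.comm 0
      rw [h.φ0] at h3
      have h4 := congrArg (· ≫ t.iso0.hom ≫ c'.i) h3
      simp only [Category.assoc, Iso.inv_hom_id_assoc] at h4
      simp only [Category.assoc, h1]
      exact h4
    · exact h.comm (i + 1)
  · change a = 𝟙 _ ≫ a ≫ 𝟙 _
    simp

end

def nilHom {Z X X' : E} (hZ : IsZero Z) (a : X ⟶ X') :
    ∀ i, (seqNil X hZ).ob i ⟶ (seqNil X' hZ).ob i
  | 0 => a
  | 1 => a
  | _ + 2 => 𝟙 Z

def GHom.nil {Z X X' : E} (hZ : IsZero Z) (a : X ⟶ X') :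
    GHom (seqNil X hZ) (seqNil X' hZ) a a where
  φ := nilHom hZ a
  comm
    | 0 => by
      change (𝟙 X ≫ 𝟙 X) ≫ a = a ≫ 𝟙 X' ≫ 𝟙 X'
      simp
    | 1 => hZ.eq_of_src _ _
    | _ + 2 => hZ.eq_of_src _ _
  φ0 := by
    change a = 𝟙 X ≫ a ≫ 𝟙 X'
    simp
  φTop := by
    change a = 𝟙 X ≫ a ≫ 𝟙 X'
    simp

lemma GHom.toSeq {Z : E} (hZ : IsZero Z) : ∀ {n : ℕ} {X Y X' Y' : E} {s : Res n X Y}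
    {t : Res n X' Y'} {a : X ⟶ X'} {k : Y ⟶ Y'}, Res.Hom n s t a k →
    Nonempty (GHom (toSeq hZ n s) (toSeq hZ n t) a k)
  | 0, _, _, _, _, _, _, _, k, h => GHom.cons h (GHom.nil hZ k)
  | n + 1, _, _, _, _, _, _, _, _, ⟨k1, h1, h2⟩ => by
    obtain ⟨g⟩ := GHom.toSeq hZ h2
    exact GHom.cons h1 g

def roundφ {n : ℕ} {X Y Y' : E} (s : EExtSeq E (n + 1) X Y) (c : Conf (s.Z 1) X)
    (hP : c.P = s.ob 1) (t : EExtSeq E n (s.Z 1) Y')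
    (φ : ∀ i, t.ob i ⟶ (seqTail s).ob i) : ∀ i, (seqCons c t).ob i ⟶ s.ob i
  | 0 => s.iso0.inv
  | 1 => eqToHom hP
  | i + 2 => φ (i + 1)

lemma GHom.round {n : ℕ} {X Y Y' : E} (s : EExtSeq E (n + 1) X Y) (t : EExtSeq E n (s.Z 1) Y')
    {k : Y' ⟶ Y} (h : GHom t (seqTail s) (𝟙 _) k) :
    Nonempty (GHom (seqCons (seqHead s) t) s (𝟙 X) k) := by
  refine ⟨⟨roundφ s (seqHead s) rfl t h.φ, ?_, ?_, h.φTop⟩⟩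
  · rintro (_ | _ | i)
    · change ((s.π 0 ≫ s.ι 0 ≫ s.iso0.hom) ≫ 𝟙 _) ≫ s.iso0.inv = 𝟙 _ ≫ s.π 0 ≫ s.ι 0
      simp
    · change (t.π 0 ≫ t.ι 0 ≫ t.iso0.hom ≫ s.ι 1) ≫ 𝟙 _ = h.φ 1 ≫ s.π 1 ≫ s.ι 1
      have h3 := h.comm 0
      rw [h.φ0] at h3
      change (t.π 0 ≫ t.ι 0) ≫ t.iso0.hom ≫ 𝟙 _ ≫ 𝟙 _ = h.φ 1 ≫ s.π 1 ≫ 𝟙 _ at h3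
      have h5 : h.φ 1 ≫ s.π 1 ≫ 𝟙 _ = h.φ 1 ≫ s.π 1 := congrArg _ (Category.comp_id _)
      have h4 := congrArg (· ≫ s.ι 1) (h3.trans h5)
      simp only [Category.assoc, Category.id_comp] at h4
      rw [Category.comp_id]
      exact h4.trans (Category.assoc _ _ _)
    · exact h.comm (i + 1)
  · change s.iso0.inv = 𝟙 _ ≫ 𝟙 _ ≫ s.iso0.inv
    simp

noncomputable def roundLastφ {X Y Z : E} (hZ : IsZero Z) (s : EExtSeq E 1 X Y) :
    ∀ i, (seqCons (seqLast s) (seqNil Y hZ)).ob i ⟶ s.ob i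
  | 0 => s.iso0.inv
  | 1 => 𝟙 (s.ob 1)
  | 2 => s.isoTop.inv
  | _ + 3 => 0

lemma GHom.roundLast {X Y Z : E} (hZ : IsZero Z) (s : EExtSeq E 1 X Y) :
    Nonempty (GHom (seqCons (seqLast s) (seqNil Y hZ)) s (𝟙 X) (𝟙 Y)) := by
  refine ⟨⟨roundLastφ hZ s, ?_, ?_, ?_⟩⟩
  · rintro (_ | _ | _ | i)
    · change ((s.π 0 ≫ s.ι 0 ≫ s.iso0.hom) ≫ 𝟙 _) ≫ s.iso0.inv = 𝟙 _ ≫ s.π 0 ≫ s.ι 0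
      simp
    · change (𝟙 Y ≫ 𝟙 Y ≫ 𝟙 Y ≫ s.isoTop.inv ≫ s.π 1 ≫ s.ι 1) ≫ 𝟙 _
        = s.isoTop.inv ≫ s.π 1 ≫ s.ι 1
      simp
    · exact hZ.eq_of_src _ _
    · exact hZ.eq_of_src _ _
  · change s.iso0.inv = 𝟙 _ ≫ 𝟙 _ ≫ s.iso0.inv
    simp
  · change s.isoTop.inv = 𝟙 _ ≫ 𝟙 _ ≫ s.isoTop.inv
    simp

lemma toSeq_ofSeq {Z : E} (hZ : IsZero Z) : ∀ (n : ℕ) {X Y : E} (s : EExtSeq E (n + 1) X Y),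
    Nonempty (GHom (toSeq hZ n (ofSeq n s)) s (𝟙 X) (𝟙 Y))
  | 0, _, _, s => GHom.roundLast hZ s
  | n + 1, _, _, s => by
    obtain ⟨h⟩ := toSeq_ofSeq hZ n (seqTail s)
    exact GHom.round s _ h

def tailConsφ {n : ℕ} {X K Y : E} (c : Conf K X) (s : EExtSeq E n K Y) :
    ∀ i, (seqTail (seqCons c s)).ob i ⟶ s.ob i
  | 0 => s.ι 0
  | i + 1 => 𝟙 (s.ob (i + 1))

def GHom.tailCons {n : ℕ} {X K Y : E} (c : Conf K X) (s : EExtSeq E n K Y) :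
    GHom (seqTail (seqCons c s)) s (s.ι 0 ≫ s.iso0.hom) (𝟙 Y) where
  φ := tailConsφ c s
  comm
    | 0 => by
      change (s.π 0 ≫ 𝟙 _) ≫ s.ι 0 = 𝟙 _ ≫ s.π 0 ≫ s.ι 0
      simp
    | i + 1 => by
      change (s.π (i + 1) ≫ s.ι (i + 1)) ≫ 𝟙 _ = 𝟙 _ ≫ s.π (i + 1) ≫ s.ι (i + 1)
      simp
  φ0 := by
    change s.ι 0 = 𝟙 _ ≫ (s.ι 0 ≫ s.iso0.hom) ≫ s.iso0.inv
    simp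
  φTop := by
    change 𝟙 _ = s.isoTop.hom ≫ 𝟙 _ ≫ s.isoTop.inv
    simp

lemma ofSeq_toSeq {Z : E} (hZ : IsZero Z) : ∀ (n : ℕ) {X Y : E} (r : Res n X Y),
    Res.Hom n (ofSeq n (toSeq hZ n r)) r (𝟙 X) (𝟙 Y)
  | 0, X, Y, c => by
    change Conf Y X at c
    change ConfHom (seqLast (seqCons c (seqNil Y hZ))) c _ _
    refine ⟨𝟙 c.P, ?_, ?_⟩
    · change (𝟙 Y ≫ 𝟙 Y ≫ 𝟙 Y ≫ 𝟙 Y ≫ c.i) ≫ 𝟙 _ = 𝟙 Y ≫ c.i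
      simp
    · change 𝟙 _ ≫ c.p = (c.p ≫ 𝟙 X ≫ 𝟙 X) ≫ 𝟙 X
      simp
  | n + 1, X, Y, ⟨K, c, r⟩ => by
    have h := (GHom.tailCons c (toSeq hZ n r)).ofSeq.comp (ofSeq_toSeq hZ n r)
    rw [Category.comp_id, Category.comp_id] at h
    refine ⟨(toSeq hZ n r).ι 0 ≫ (toSeq hZ n r).iso0.hom, ⟨𝟙 c.P, ?_, ?_⟩, h⟩
    · change ((toSeq hZ n r).ι 0 ≫ (toSeq hZ n r).iso0.hom ≫ c.i) ≫ 𝟙 _ = _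
      rw [Category.comp_id]
      exact (Category.assoc _ _ _).symm
    · change 𝟙 _ ≫ c.p = (c.p ≫ 𝟙 X ≫ 𝟙 X) ≫ 𝟙 X
      simp

lemma eExtVanish_iff_vanish {n : ℕ} {X Y : E} : eExtVanish E (n + 1) X Y ↔ Res.Vanish n X Y := by
  obtain ⟨Z, hZ⟩ := exists_isZero X
  constructor
  · intro h r1 r2
    have key : ∀ s t : EExtSeq E (n + 1) X Y, EYonedaEquiv s t →
        Res.Eqv (ofSeq n s) (ofSeq n t) := by
      intro s t h
      induction h with
      | rel _ _ h => exact .rel _ _ (GHom.ofHom h.some).ofSeq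
      | refl => exact .refl _
      | symm _ _ _ ih => exact .symm _ _ ih
      | trans _ _ _ _ _ h1 h2 => exact .trans _ _ _ h1 h2
    exact .trans _ _ _ (.symm _ _ (.rel _ _ (ofSeq_toSeq hZ n r1)))
      (.trans _ _ _ (key _ _ (h (toSeq hZ n r1) (toSeq hZ n r2)))
        (.rel _ _ (ofSeq_toSeq hZ n r2)))
  · intro h s1 s2
    have key : ∀ s t : Res n X Y, Res.Eqv s t →
        EYonedaEquiv (toSeq hZ n s) (toSeq hZ n t) := by
      intro s t h
      induction h with
      | rel _ _ h => exact .rel _ _ ((GHom.toSeq hZ h).map GHom.toHom)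
      | refl => exact .refl _
      | symm _ _ _ ih => exact .symm _ _ ih
      | trans _ _ _ _ _ h1 h2 => exact .trans _ _ _ h1 h2
    exact .trans _ _ _ (.symm _ _ (.rel _ _ ((toSeq_ofSeq hZ n s1).map GHom.toHom)))
      (.trans _ _ _ (key _ _ (h (ofSeq n s1) (ofSeq n s2)))
        (.rel _ _ ((toSeq_ofSeq hZ n s2).map GHom.toHom)))

lemma eExtVanish_iff_van {n : ℕ} {X Y : E} : eExtVanish E (n + 1) X Y ↔ Res.Van n X Y := by
  rw [eExtVanish_iff_vanish, Res.van_iff_vanish]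

end
end DCT

namespace DCT

open Opposite

section
set_option linter.unusedSectionVars false
set_option linter.unusedVariables false
variable [ExactCatStruct E] [IsExactCat E]

/-! ### The main argument -/

/-- The half of the cluster tilting axioms needed for right approximations. -/
structure Half (ℳ : Set E) (d : ℕ) : Prop where
  gen : ∀ X : E, ∃ M ∈ ℳ, ∃ f : M ⟶ X, Deflation f
  cfin : ∀ X : E, ∃ M ∈ ℳ, ∃ f : M ⟶ X, ∀ M' ∈ ℳ, ∀ g : M' ⟶ X, ∃ h : M' ⟶ M, h ≫ f = g
  perp : ∀ X : E, X ∈ ℳ ↔ ∀ n, n + 1 < d → ∀ M ∈ ℳ, Res.Van n M X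

lemma Half.approx {ℳ : Set E} {d : ℕ} (H : Half ℳ d) (X : E) :
    ∃ (K : E) (c : Conf K X), c.P ∈ ℳ ∧ ∀ N ∈ ℳ, ∀ g : N ⟶ X, ∃ g' : N ⟶ c.P, g' ≫ c.p = g := by
  obtain ⟨M, hM, f, hf⟩ := H.cfin X
  obtain ⟨M1, hM1, p, K1, i, w, hp⟩ := H.gen X
  let c1 : Conf K1 X := ⟨M1, i, p, w, hp⟩
  obtain ⟨c, σ, h, e1, e2, e3, e4⟩ := exists_split M X
  obtain ⟨c', φ, hpb, -⟩ := c1.pullback c.p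
  obtain ⟨a, ha1, ha2⟩ : ∃ a : M ⟶ c'.P, a ≫ φ = 0 ∧ a ≫ c'.p = c.i :=
    ⟨hpb.lift 0 c.i (by simp), by simp, by simp⟩
  obtain ⟨b, hb1, hb2⟩ : ∃ b : M1 ⟶ c'.P, b ≫ φ = 𝟙 M1 ∧ b ≫ c'.p = p ≫ σ :=
    ⟨hpb.lift (𝟙 M1) (p ≫ σ) (by simp [e1, c1]), by simp [c1], by simp⟩
  have hsum : φ ≫ b + (c'.p ≫ h) ≫ a = 𝟙 c'.P := by
    apply hpb.hom_ext
    · simp [ha1, hb1]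
      exact Category.comp_id _
    · have hw : φ ≫ p = c'.p ≫ c.p := hpb.w
      have : φ ≫ p ≫ σ = c'.p ≫ c.p ≫ σ := by rw [← Category.assoc, hw, Category.assoc]
      simp only [Preadditive.add_comp, Category.assoc, ha2, Category.id_comp]
      calc φ ≫ b ≫ c'.p + c'.p ≫ h ≫ c.i = φ ≫ p ≫ σ + c'.p ≫ h ≫ c.i := by
            exact congrArg (· + _) (congrArg (φ ≫ ·) hb2)
        _ = c'.p := by rw [this, ← Preadditive.comp_add, e4, Category.comp_id]
  have hW : c'.P ∈ ℳ := by
    rw [H.perp]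
    intro n hn N hN
    exact Res.van_split φ b (c'.p ≫ h) a hsum ((H.perp M).1 hM n hn N hN)
      ((H.perp M1).1 hM1 n hn N hN)
  have hn2 : (h ≫ f ≫ σ) ≫ h ≫ f ≫ σ = 0 := by
    simp only [Category.assoc]
    rw [reassoc_of% e3]
    simp
  let θ : c.P ≅ c.P := ⟨𝟙 _ + h ≫ f ≫ σ, 𝟙 _ - h ≫ f ≫ σ, by
      rw [Preadditive.add_comp, Preadditive.comp_sub, Preadditive.comp_sub, hn2]; simp, by
      rw [Preadditive.sub_comp, Preadditive.comp_add, Preadditive.comp_add, hn2]; simp⟩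
  have hq : c.p + h ≫ f = θ.hom ≫ c.p := by
    simp [θ, e1]
  let c2 : Conf M X := c.iso (Iso.refl _) θ (Iso.refl _) (c.i ≫ θ.inv) (c.p + h ≫ f) (by simp)
    (by simp [hq])
  obtain ⟨K, j, w, hj⟩ := IsExactCat.comp_deflation _ _ c'.deflation c2.deflation
  refine ⟨K, ⟨c'.P, j, _, w, hj⟩, hW, ?_⟩
  intro N hN g
  obtain ⟨t, ht⟩ := hf N hN g
  refine ⟨t ≫ a, ?_⟩
  change (t ≫ a) ≫ c'.p ≫ (c.p + h ≫ f) = g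
  rw [Category.assoc, reassoc_of% ha2, Preadditive.comp_add, c.w, zero_add, reassoc_of% e2, ht]

lemma Half.step {ℳ : Set E} {d : ℕ} (H : Half ℳ d) (X : E) (k : ℕ) (hk : k + 1 ≤ d)
    (hX : ∀ j, j + 1 < k → ∀ M ∈ ℳ, Res.Van j M X) :
    ∃ (K : E) (c : Conf K X), c.P ∈ ℳ ∧ ∀ j, j + 1 < k + 1 → ∀ M ∈ ℳ, Res.Van j M K := by
  obtain ⟨K, c, hP, hc⟩ := H.approx X
  refine ⟨K, c, hP, ?_⟩
  rintro (_ | j) hj M hM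
  · exact Res.van_b0 c (hc M hM) ((H.perp _).1 hP 0 (by omega) M hM)
  · exact Res.van_b c (hX j (by omega) M hM) ((H.perp _).1 hP (j + 1) (by omega) M hM)

lemma Half.resolution {ℳ : Set E} {d : ℕ} (H : Half ℳ d) : ∀ (m : ℕ) (X : E), m ≤ d →
    (∀ j, j + 1 < d - m → ∀ M ∈ ℳ, Res.Van j M X) →
    ∃ (T : E) (s : EExtSeq E m X T), ∀ i, 0 < i → i ≤ m + 1 → s.ob i ∈ ℳ
  | 0, X, _, hX => by
    obtain ⟨Z, hZ⟩ := exists_isZero X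
    refine ⟨X, seqNil X hZ, fun i h0 h1 => ?_⟩
    obtain rfl : i = 1 := by omega
    exact (H.perp X).2 fun n hn => hX n (by omega)
  | m + 1, X, hm, hX => by
    obtain ⟨K, c, hP, hK⟩ := H.step X (d - (m + 1)) (by omega) hX
    obtain ⟨T, s, hs⟩ := H.resolution m K (by omega) fun j hj => hK j (by omega)
    refine ⟨T, seqCons c s, ?_⟩
    rintro (_ | _ | i) h0 h1
    · omega
    · exact hP
    · exact hs (i + 1) (by omega) (by omega)

lemma Half.extend {ℳ : Set E} {d : ℕ} (H : Half (E := Eᵒᵖ) {Y : Eᵒᵖ | Y.unop ∈ ℳ} d) {X T : E}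
    {m : ℕ} (s : EExtSeq E m X T) (hs : ∀ i, 0 < i → i ≤ m + 1 → s.ob i ∈ ℳ)
    (hX : ∀ j, j + 1 < m → ∀ M ∈ ℳ, Res.Van j X M) : ∀ k, m + k ≤ d →
    ∃ (C : E) (s : EExtSeq E (m + k) C T), (∀ i, 0 < i → i ≤ m + k + 1 → s.ob i ∈ ℳ) ∧
      Nonempty (X ≅ s.Z k) ∧ ∀ j, j + 1 < m + k → ∀ M ∈ ℳ, Res.Van j C M
  | 0, _ => ⟨X, s, hs, ⟨(isoBot s).symm⟩, hX⟩
  | k + 1, hk => by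
    obtain ⟨C, s, hs, ⟨e⟩, hC⟩ := Half.extend H s hs hX k (by omega)
    obtain ⟨K, c, hP, hK⟩ := H.step (op C) (m + k) (by omega)
      fun j hj M hM => Res.van_op_iff.2 (hC j hj M.unop hM)
    refine ⟨K.unop, seqCons c.unop s, ?_, ⟨e⟩, ?_⟩
    · rintro (_ | _ | i) h0 h1
      · omega
      · exact hP
      · exact hs (i + 1) (by omega) (by omega)
    · intro j hj M hM
      exact Res.van_op_iff.1 (hK j (by omega) (op M) hM)

lemma Half.back {ℳ : Set E} {d : ℕ} (H : Half ℳ d) {B T : E} (s : EExtSeq E d B T)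
    (hs : ∀ i, i ≤ d + 1 → s.ob i ∈ ℳ) : ∀ k, k ≤ d → ∀ j, j + 1 < d - k → ∀ M ∈ ℳ,
      Res.Van j M (s.Z (d - k))
  | 0, _, j, hj, M, hM => by
    have := (H.perp _).1 (hs (d + 1) le_rfl) j (by omega) M hM
    exact this.of_iso (s.isoTop ≪≫ isoTopZ s)
  | k + 1, hk, j, hj, M, hM => by
    have h1 := H.back s hs k (by omega) (j + 1) (by omega) M hM
    have h2 : d - k = d - (k + 1) + 1 := by omega
    rw [h2] at h1
    exact Res.van_a (seqConf s (d - (k + 1)))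
      ((H.perp _).1 (hs (d - (k + 1) + 1) (by omega)) j (by omega) M hM) h1

lemma Half.forth {ℳ : Set E} {d : ℕ} (H : Half (E := Eᵒᵖ) {Y : Eᵒᵖ | Y.unop ∈ ℳ} d) {B T : E}
    (s : EExtSeq E d B T)
    (hs : ∀ i, i ≤ d + 1 → s.ob i ∈ ℳ) : ∀ k, k ≤ d → ∀ j, j + 1 < d - k → ∀ M ∈ ℳ,
      Res.Van j (s.Z k) M
  | 0, _, j, hj, M, hM => by
    have := (H.perp (op (s.ob 0))).1 (hs 0 (by omega)) j (by omega) (op M) hM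
    have := Res.van_op_iff.1 this
    exact (Res.van_iso_iff' (isoBot s ≪≫ s.iso0.symm)).2 this
  | k + 1, hk, j, hj, M, hM => by
    have h1 := Half.forth H s hs k (by omega) (j + 1) (by omega) M hM
    have h2 := (H.perp (op (s.ob (k + 1)))).1 (hs (k + 1) (by omega)) j (by omega) (op M) hM
    exact Res.van_op_iff.1 (Res.van_a (seqConf s k).op h2 (Res.van_op_iff.2 h1))

lemma half_of {ℳ : Set E} {d : ℕ} (hM : IsDCT E ℳ d) : Half ℳ d where
  gen := hM.generating
  cfin := hM.contravariantly_finite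
  perp X := by
    refine (Set.ext_iff.1 hM.eq_right_perp X).trans ⟨?_, ?_⟩
    · intro h n hn M hM
      exact eExtVanish_iff_van.1 (h (n + 1) (by omega) hn M hM)
    · rintro h (_ | n) h0 hn M hM
      · omega
      · exact eExtVanish_iff_van.2 (h n hn M hM)

lemma half_op_of {ℳ : Set E} {d : ℕ} (hM : IsDCT E ℳ d) :
    Half (E := Eᵒᵖ) {Y : Eᵒᵖ | Y.unop ∈ ℳ} d where
  gen X := by
    obtain ⟨M, h, f, hf⟩ := hM.cogenerating X.unop
    exact ⟨op M, h, f.op, inflation_op hf⟩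
  cfin X := by
    obtain ⟨M, h, f, hf⟩ := hM.covariantly_finite X.unop
    refine ⟨op M, h, f.op, fun M' hM' g => ?_⟩
    obtain ⟨t, ht⟩ := hf M'.unop hM' g.unop
    exact ⟨t.op, Quiver.Hom.unop_inj ht⟩
  perp X := by
    refine (Set.ext_iff.1 hM.eq_left_perp X.unop).trans ⟨?_, ?_⟩
    · intro h n hn M hM
      exact Res.van_op_iff.2 (eExtVanish_iff_van.1 (h (n + 1) (by omega) hn M.unop hM))
    · rintro h (_ | n) h0 hn M hM
      · omega
      · exact eExtVanish_iff_van.2 (Res.van_op_iff.1 (h n hn (op M) hM))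

lemma mem_iff {ℳ : Set E} {d : ℕ} (hM : IsDCT E ℳ d) {m n : ℕ} (hmn : m + n = d) (X : E) :
    X ∈ Emn E ℳ m n ↔
      ∃ (B T : E) (s : EExtSeq E d B T),
        (∀ i, i ≤ d + 1 → s.ob i ∈ ℳ) ∧ Nonempty (X ≅ s.Z n) := by
  have H := half_of hM
  have H' := half_op_of hM
  constructor
  · rintro ⟨h1, h2⟩
    obtain ⟨T, s, hs⟩ := H.resolution m X (by omega)
      fun j hj M hM => eExtVanish_iff_van.1 (h2 (j + 1) (by omega) (by omega) M hM)
    obtain ⟨C, s, hs, e, hC⟩ := Half.extend H' s hs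
      (fun j hj M hM => eExtVanish_iff_van.1 (h1 (j + 1) (by omega) hj M hM)) n (by omega)
    subst hmn
    refine ⟨C, T, s, ?_, e⟩
    intro i hi
    rcases Nat.eq_zero_or_pos i with rfl | h0
    · refine hM.iso_closed _ _ s.iso0.symm ((H'.perp (op C)).2 fun j hj M hM => ?_)
      exact Res.van_op_iff.2 (hC j hj M.unop hM)
    · exact hs i h0 hi
  · rintro ⟨B, T, s, hs, ⟨e⟩⟩
    constructor
    · rintro (_ | i) h0 hi M hM
      · omega
      · exact eExtVanish_iff_van.2 ((Res.van_iso_iff' e).2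
          (Half.forth H' s hs n (by omega) i (by omega) M hM))
    · rintro (_ | i) h0 hi M hM
      · omega
      · have := H.back s hs m (by omega) i (by omega) M hM
        rw [show d - m = n by omega] at this
        exact eExtVanish_iff_van.2 ((Res.van_iso_iff e).2 this)

end
end DCT

/-- for `m, n > 0` with `m + n = d`, an object `X` lies in `E_{m,n}` if and
only if there is an exact sequence `0 → M_{d+1} → ⋯ → M_0 → 0` with all terms in `ℳ` such
that `X` is isomorphic to the image of `M_{n+1} → M_n`. -/
theorem mem_Emn_iff_image_in_adm_d_exact
    (E : Type u) [Category.{v} E] [Preadditive E] [HasZeroObject E] [HasBinaryBiproducts E]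
    [ExactCatStruct E] [IsExactCat E]
    (hwic : WeaklyIdemComplete E)
    (d : ℕ) (ℳ : Set E) (hM : IsDCT E ℳ d)
    (m n : ℕ) (hm : 0 < m) (hn : 0 < n) (hmn : m + n = d) (X : E) :
    X ∈ Emn E ℳ m n ↔
      ∃ (B T : E) (s : EExtSeq E d B T),
        (∀ i, i ≤ d + 1 → s.ob i ∈ ℳ) ∧ Nonempty (X ≅ s.Z n) := by
  exact DCT.mem_iff hM hmn X
end
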